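/- arXiv:2203.16900 — 6 statements merged into one kernel-verified Lean document; each statement's English description precedes it below -/
import Mathlib

section
/- For every pair of integers t, k ≥ 1 there exists an integer N such that the following holds: every finite simple graph G that contains none of P_t, the complement of P_t, and R_k as an induced subgraph admits a partition of its vertex set into at most N parts, each of which induces a graph with no induced P_4 (i.e., a cograph). (This is the size part of Theorem 2; the height bound on the cographs is omitted.) -/
/-- The path graph on `t` vertices: `i` and `j` are adjacent iff `|i - j| = 1`. -/
def pathG (t : ℕ) : SimpleGraph (Fin t) :=
  SimpleGraph.fromRel (fun i j => (i : ℕ) + 1 = (j : ℕ))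

/-- `G` contains `H` as an induced subgraph. -/
def ContainsInduced {W V : Type*} (H : SimpleGraph W) (G : SimpleGraph V) : Prop :=
  ∃ f : W → V, Function.Injective f ∧
    ∀ u v : W, u ≠ v → (G.Adj (f u) (f v) ↔ H.Adj u v)

/-- The universal threshold graph `R_k`: vertices `a_1,…,a_k` (a clique) and
`b_1,…,b_k` (an independent set), with `a_i` adjacent to `b_j` iff `i ≤ j`. -/
def Rgraph (k : ℕ) : SimpleGraph (Fin k ⊕ Fin k) :=
  SimpleGraph.fromRel (fun x y =>
    match x, y with
    | Sum.inl _, Sum.inl _ => True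
    | Sum.inl i, Sum.inr j => i ≤ j
    | _, _ => False)

/-- A cograph is a graph with no induced `P₄`. -/
def IsCograph {V : Type*} (G : SimpleGraph V) : Prop :=
  ¬ ContainsInduced (pathG 4) G

/-- The set `S` induces a cograph in `G`: no four vertices of `S` form an induced `P₄`. -/
def CographOn {V : Type*} (G : SimpleGraph V) (S : Set V) : Prop :=
  ∀ a ∈ S, ∀ b ∈ S, ∀ c ∈ S, ∀ d ∈ S, G.Adj a b → G.Adj b c → G.Adj c d →
    ¬ G.Adj a c → ¬ G.Adj b d → ¬ G.Adj a d → False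

/-- The set `S` can be partitioned into `n` sets each inducing a cograph in `G`. -/
def CographColorable {V : Type*} (G : SimpleGraph V) (S : Set V) (n : ℕ) : Prop :=
  ∃ c : V → ℕ, (∀ v ∈ S, c v < n) ∧ ∀ i, CographOn G {v | v ∈ S ∧ c v = i}

/-- `p 0, …, p (s - 1)` is an induced path of `G` with all its vertices in `C`. -/
def IsInducedPathIn {V : Type*} (G : SimpleGraph V) (C : Set V) (s : ℕ) (p : ℕ → V) : Prop :=
  (∀ i < s, p i ∈ C) ∧ (∀ i < s, ∀ j < s, p i = p j → i = j) ∧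
    ∀ i < s, ∀ j < s, (G.Adj (p i) (p j) ↔ i + 1 = j ∨ j + 1 = i)

/-- `y` can be reached from `x` by a walk inside `C`. -/
def ReachIn {V : Type*} (G : SimpleGraph V) (C : Set V) : V → V → Prop :=
  Relation.ReflTransGen (fun a b => G.Adj a b ∧ a ∈ C ∧ b ∈ C)

/-- The sequences `a` and `b` of length `j` form a copy of `R_j` inside `S`. -/
def IsThresholdIn {V : Type*} (G : SimpleGraph V) (S : Set V) (j : ℕ) (a b : ℕ → V) : Prop :=
  (∀ i < j, a i ∈ S ∧ b i ∈ S) ∧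
    ∀ i < j, ∀ i' < j, (G.Adj (a i) (a i') ↔ i ≠ i') ∧ ¬ G.Adj (b i) (b i') ∧
      (G.Adj (a i) (b i') ↔ i ≤ i')

section

variable {V : Type*} {G : SimpleGraph V}

theorem CographOn.mono {S T : Set V} (h : CographOn G T) (hST : S ⊆ T) : CographOn G S :=
  fun a ha b hb c hc d hd => h a (hST ha) b (hST hb) c (hST hc) d (hST hd)

theorem CographOn.compl {S : Set V} (h : CographOn G S) : CographOn Gᶜ S := by
  intro a ha b hb c hc d hd hab hbc hcd hac hbd had
  have := h b hb d hd a ha c hc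
  simp only [SimpleGraph.compl_adj] at *
  grind [SimpleGraph.adj_comm]

theorem CographColorable.mono {S T : Set V} {n : ℕ} (h : CographColorable G T n) (hST : S ⊆ T) :
    CographColorable G S n := by
  obtain ⟨c, hc, hco⟩ := h
  exact ⟨c, fun v hv => hc v (hST hv), fun i => (hco i).mono fun v hv => ⟨hST hv.1, hv.2⟩⟩

theorem CographColorable.compl {S : Set V} {n : ℕ} (h : CographColorable G S n) :
    CographColorable Gᶜ S n := by
  obtain ⟨c, hc, hco⟩ := h
  exact ⟨c, hc, fun i => (hco i).compl⟩

theorem cographColorable_singleton (v : V) : CographColorable G {v} 1 := by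
  refine ⟨fun _ => 0, by simp, fun i a ha b hb _ _ _ _ hab => ?_⟩
  obtain rfl : a = v := ha.1
  obtain rfl : b = a := hb.1
  simp at hab

theorem CographColorable.union {S T : Set V} {m n : ℕ} (hS : CographColorable G S m)
    (hT : CographColorable G T n) : CographColorable G (S ∪ T) (m + n) := by
  classical
  obtain ⟨c, hc, hco⟩ := hS
  obtain ⟨d, hd, hdo⟩ := hT
  refine ⟨fun v => if v ∈ S then c v else m + d v, fun v hv => ?_, fun i => ?_⟩
  · by_cases h : v ∈ S
    · simpa [h] using (hc v h).trans_le (Nat.le_add_right _ _)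
    · simpa [h] using hd v (hv.resolve_left h)
  · by_cases hi : i < m
    · refine (hco i).mono fun v hv => ?_
      obtain ⟨hv, h⟩ := hv
      grind
    · refine (hdo (i - m)).mono fun v hv => ?_
      obtain ⟨hv, h⟩ := hv
      have := hc v
      have : v ∈ T ∨ v ∈ S := hv.symm
      simp only [Set.mem_ofPred_eq]
      grind

/-- Colorings of the parts of a disjoint union can be combined without new colors. -/
theorem CographColorable.of_components {α : Type*} {S : Set V} {n : ℕ} (f : V → α)
    (hf : ∀ x ∈ S, ∀ y ∈ S, G.Adj x y → f x = f y)
    (h : ∀ i, CographColorable G {x | x ∈ S ∧ f x = i} n) : CographColorable G S n := by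
  choose c hc hco using h
  refine ⟨fun v => c (f v) v, fun v hv => hc _ v ⟨hv, rfl⟩, fun i => ?_⟩
  rintro x ⟨hx, hxi⟩ y ⟨hy, hyi⟩ z ⟨hz, hzi⟩ w ⟨hw, hwi⟩ hxy hyz hzw
  have h1 := hf x hx y hy hxy
  have h2 := hf y hy z hz hyz
  have h3 := hf z hz w hw hzw
  refine hco (f x) i x ⟨⟨hx, rfl⟩, hxi⟩ y ⟨⟨hy, ?_⟩, ?_⟩ z ⟨⟨hz, ?_⟩, ?_⟩ w ⟨⟨hw, ?_⟩, ?_⟩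
    hxy hyz hzw <;> simp_all

theorem ReachIn.symm {C : Set V} {x y : V} (h : ReachIn G C x y) : ReachIn G C y x :=
  Relation.ReflTransGen.mono (fun _ _ h => ⟨h.1.symm, h.2.2, h.2.1⟩) _ _ h.swap

/-- It suffices to color the connected components. -/
theorem CographColorable.of_reachIn {S : Set V} {n : ℕ}
    (h : ∀ x ∈ S, CographColorable G {y | y ∈ S ∧ ReachIn G S x y} n) :
    CographColorable G S n := by
  refine .of_components (fun x => {y | ReachIn G S x y}) (fun x hx y hy hxy => ?_) fun D => ?_
  · have hr : ReachIn G S x y := .single ⟨hxy, hx, hy⟩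
    ext z
    exact ⟨fun hz => hr.symm.trans hz, fun hz => hr.trans hz⟩
  · by_cases hD : ∃ x ∈ S, {y | ReachIn G S x y} = D
    · obtain ⟨x, hx, rfl⟩ := hD
      refine (h x hx).mono fun y hy => ⟨hy.1, ?_⟩
      have : y ∈ {z | ReachIn G S y z} := Relation.ReflTransGen.refl
      rwa [hy.2] at this
    · refine ⟨fun _ => 0, fun v hv => (hD ⟨v, hv⟩).elim, fun i a ha => (hD ⟨a, ha.1⟩).elim⟩

theorem ReachIn.restrict {C : Set V} {x y : V} (h : ReachIn G C x y) :
    ReachIn G {z | z ∈ C ∧ ReachIn G C x z} x y := by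
  induction h with
  | refl => exact .refl
  | tail hb hbc ih => exact ih.tail ⟨hbc.1, ⟨hbc.2.1, hb⟩, hbc.2.2, hb.tail hbc⟩

theorem ReachIn.mono {C D : Set V} {x y : V} (hCD : C ⊆ D) (h : ReachIn G C x y) :
    ReachIn G D x y :=
  Relation.ReflTransGen.mono (fun _ _ h => ⟨h.1, hCD h.2.1, hCD h.2.2⟩) _ _ h

theorem ReachIn.exists_neighbor {C : Set V} {v x : V} (h : ReachIn G C v x)
    (hx : x ∈ {z | z ∈ C ∧ z ≠ v ∧ ¬ G.Adj v z}) :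
    ∃ u ∈ C, G.Adj v u ∧ ∃ y ∈ {z | z ∈ C ∧ z ≠ v ∧ ¬ G.Adj v z},
      G.Adj u y ∧ ReachIn G {z | z ∈ C ∧ z ≠ v ∧ ¬ G.Adj v z} y x := by
  induction h with
  | refl => exact (hx.2.1 rfl).elim
  | @tail b c hb hbc ih =>
    by_cases hbT : b ∈ {z | z ∈ C ∧ z ≠ v ∧ ¬ G.Adj v z}
    · obtain ⟨u, hu, hvu, y, hy, huy, hyb⟩ := ih hbT
      exact ⟨u, hu, hvu, y, hy, huy, hyb.tail ⟨hbc.1, hbT, hx⟩⟩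
    · by_cases hbv : b = v
      · exact (hx.2.2 (hbv ▸ hbc.1)).elim
      · have hvb : G.Adj v b := by
          by_contra hn
          exact hbT ⟨hbc.2.1, hbv, hn⟩
        exact ⟨b, hbc.2.1, hvb, c, hx, hbc.1, .refl⟩

theorem IsInducedPathIn.cons {C D : Set V} {s : ℕ} {p : ℕ → V} {v : V}
    (hp : IsInducedPathIn G D s p) (hv : v ∈ C) (hDC : D ⊆ C) (hvD : v ∉ D)
    (h0 : G.Adj v (p 0)) (hD : ∀ x ∈ D, x ≠ p 0 → ¬ G.Adj v x) :
    IsInducedPathIn G C (s + 1) (fun i => Nat.casesOn i v p) := by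
  obtain ⟨hmem, hinj, hadj⟩ := hp
  have key : ∀ i < s, (G.Adj v (p i) ↔ i = 0) := by
    intro i hi
    refine ⟨fun h => ?_, fun h => h ▸ h0⟩
    by_contra hne
    exact hD _ (hmem i hi) (fun he => hne (hinj i hi 0 (by omega) he)) h
  refine ⟨?_, ?_, ?_⟩
  · rintro (_ | i) hi
    · exact hv
    · exact hDC (hmem i (by omega))
  · rintro (_ | i) hi (_ | j) hj h
    · rfl
    · exact (hvD (by rw [show v = p j from h]; exact hmem j (by omega))).elim
    · exact (hvD (by rw [← show p i = v from h]; exact hmem i (by omega))).elim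
    · rw [hinj i (by omega) j (by omega) h]
  · rintro (_ | i) hi (_ | j) hj
    · simp
    · simpa [eq_comm] using key j (by omega)
    · simpa [G.adj_comm, eq_comm] using key i (by omega)
    · simpa using hadj i (by omega) j (by omega)

/-- The path argument of Gyárfás for cograph colorings, in a connected set. -/
theorem cographColorable_of_no_path_from {S : Set V} {m : ℕ}
    (hm : ∀ u ∈ S, CographColorable G {x | x ∈ S ∧ G.Adj u x} m) (s : ℕ) :
    ∀ C ⊆ S, ∀ v ∈ C, (∀ x ∈ C, ReachIn G C v x) →
      (¬ ∃ p, p 0 = v ∧ IsInducedPathIn G C s p) → CographColorable G C (s * (m + 1)) := by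
  induction s with
  | zero =>
    intro C _ v _ _ hp
    exact (hp ⟨fun _ => v, rfl, by simp [IsInducedPathIn]⟩).elim
  | succ s ih =>
    intro C hCS v hv hconn hp
    set T : Set V := {z | z ∈ C ∧ z ≠ v ∧ ¬ G.Adj v z} with hT
    have hTcol : CographColorable G T (s * (m + 1)) := by
      refine .of_reachIn fun x hx => ?_
      obtain ⟨u, huC, hvu, y, hy, huy, hyx⟩ := (hconn x hx.1).exists_neighbor hx
      set D : Set V := insert u {z | z ∈ T ∧ ReachIn G T y z} with hDdef
      have hDC : D ⊆ C := Set.insert_subset huC fun z hz => hz.1.1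
      have huD : u ∈ D := Set.mem_insert _ _
      refine (ih D (hDC.trans hCS) u huD ?_ ?_).mono fun z hz => Or.inr ⟨hz.1, hyx.trans hz.2⟩
      · rintro z (rfl | hz)
        · exact .refl
        · have h1 : ReachIn G D u y := .single ⟨huy, huD, Or.inr ⟨hy, .refl⟩⟩
          exact h1.trans (hz.2.restrict.mono (Set.subset_insert _ _))
      · rintro ⟨p, hp0, hpath⟩
        refine hp ⟨_, rfl, hpath.cons hv hDC ?_ (hp0 ▸ hvu) ?_⟩
        · rintro (h | h)
          · exact hvu.ne h
          · exact h.1.2.1 rfl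
        · rintro z (h | h) hne
          · exact (hne (h.trans hp0.symm)).elim
          · exact h.1.2.2
    have := hTcol.union ((hm v (hCS hv)).union (cographColorable_singleton v))
    rw [Nat.succ_mul]
    refine this.mono fun z hz => ?_
    by_cases h1 : z = v
    · exact Or.inr (Or.inr h1)
    · by_cases h2 : G.Adj v z
      · exact Or.inr (Or.inl ⟨hCS hz, h2⟩)
      · exact Or.inl ⟨hz, h1, h2⟩

/-- In a `P_t`-free graph, bounded neighborhoods force a bounded cograph coloring. -/
theorem cographColorable_of_neighbors {t m : ℕ} (hG : ¬ ContainsInduced (pathG t) G) {S : Set V}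
    (hm : ∀ u ∈ S, CographColorable G {x | x ∈ S ∧ G.Adj u x} m) :
    CographColorable G S (t * (m + 1)) := by
  refine .of_reachIn fun x hx => ?_
  refine cographColorable_of_no_path_from hm t _ (fun z hz => hz.1) x ⟨hx, .refl⟩
    (fun z hz => hz.2.restrict) ?_
  rintro ⟨p, -, -, hinj, hadj⟩
  refine hG ⟨fun i => p i, fun i j h => Fin.ext (hinj i i.2 j j.2 h), fun i j hij => ?_⟩
  simp [pathG, hij, hadj i i.2 j j.2]

theorem exists_neighbors_not_cographColorable {t m : ℕ} (hG : ¬ ContainsInduced (pathG t) G)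
    {S : Set V} (hS : ¬ CographColorable G S (t * (m + 1))) :
    ∃ u ∈ S, ¬ CographColorable G {x | x ∈ S ∧ G.Adj u x} m := by
  by_contra! h
  exact hS (cographColorable_of_neighbors hG h)

theorem not_containsInduced_compl {W : Type*} {H : SimpleGraph W}
    (hG : ¬ ContainsInduced Hᶜ G) : ¬ ContainsInduced H Gᶜ := by
  rintro ⟨f, hf, h⟩
  refine hG ⟨f, hf, fun u v huv => ?_⟩
  have := h u v huv
  simp only [SimpleGraph.compl_adj, ne_eq, hf.eq_iff, huv, not_false_eq_true, true_and] at *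
  tauto

theorem IsThresholdIn.cons {S T : Set V} {j : ℕ} {a b : ℕ → V} {x y : V}
    (h : IsThresholdIn G T j a b) (hTS : T ⊆ S) (hx : x ∈ S) (hy : y ∈ S) (hxy : G.Adj x y)
    (hxT : ∀ z ∈ T, G.Adj x z) (hyT : ∀ z ∈ T, ¬ G.Adj y z) :
    IsThresholdIn G S (j + 1) (fun i => Nat.casesOn i x a) (fun i => Nat.casesOn i y b) := by
  obtain ⟨hmem, hadj⟩ := h
  refine ⟨?_, ?_⟩
  · rintro (_ | i) hi
    · exact ⟨hx, hy⟩
    · exact ⟨hTS (hmem i (by omega)).1, hTS (hmem i (by omega)).2⟩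
  · rintro (_ | i) hi (_ | i') hi'
    · simpa using hxy
    · have := hmem i' (by omega)
      simp [hxT _ this.1, hxT _ this.2, hyT _ this.2]
    · have := hmem i (by omega)
      simp [(hxT _ this.1).symm, G.adj_comm _ y, hyT _ this.1, hyT _ this.2]
    · simpa using hadj i (by omega) i' (by omega)

theorem IsThresholdIn.containsInduced {S : Set V} {k : ℕ} {a b : ℕ → V}
    (h : IsThresholdIn G S k a b) : ContainsInduced (Rgraph k) G := by
  have haa := fun i j : Fin k => (h.2 i i.2 j j.2).1
  have hbb := fun i j : Fin k => (h.2 i i.2 j j.2).2.1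
  have hab := fun i j : Fin k => (h.2 i i.2 j j.2).2.2
  have hne : ∀ i j : Fin k, a i ≠ b j := fun i j hij => hbb j i (hij ▸ (hab i i).2 le_rfl)
  refine ⟨Sum.elim (fun i => a i) (fun i => b i), ?_, ?_⟩
  · refine Function.Injective.sumElim (fun i j hij => ?_) (fun i j hij => ?_) hne
    · by_contra hn
      have h1 := (haa i j).2 (fun h => hn (Fin.ext h))
      exact h1.ne hij
    · have hij : b i = b j := hij
      have h1 := (hab i j).1 (hij ▸ (hab i i).2 le_rfl)
      have h2 := (hab j i).1 (hij ▸ (hab j j).2 le_rfl)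
      exact Fin.ext (le_antisymm h1 h2)
  · rintro (i | i) (j | j) huv
    · have : i ≠ j := fun h => huv (h ▸ rfl)
      simp [Rgraph, haa, this, Fin.val_inj]
    · simp [Rgraph, hab]
    · simp [Rgraph, hab, G.adj_comm (b i)]
    · simp [Rgraph, hbb]

/-- A number of colors that suffices for graphs without induced `P_t`, its complement
and `R_j`. -/
def cographBound (t : ℕ) : ℕ → ℕ
  | 0 => 0
  | j + 1 => t * (t * (cographBound t j + 1) + 1)

theorem exists_isThresholdIn {t : ℕ} (hG : ¬ ContainsInduced (pathG t) G)
    (hG' : ¬ ContainsInduced (pathG t)ᶜ G) (j : ℕ) :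
    ∀ S : Set V, ¬ CographColorable G S (cographBound t j) → ∃ a b, IsThresholdIn G S j a b := by
  induction j with
  | zero =>
    intro S hS
    obtain ⟨v, -⟩ : S.Nonempty := by
      by_contra hn
      rw [Set.not_nonempty_iff_eq_empty] at hn
      exact hS ⟨fun _ => 0, by simp [hn], fun i a ha => by simp [hn] at ha⟩
    exact ⟨fun _ => v, fun _ => v, by simp [IsThresholdIn]⟩
  | succ j ih =>
    intro S hS
    obtain ⟨x, hx, hxS⟩ := exists_neighbors_not_cographColorable hG hS
    obtain ⟨y, hy, hyS⟩ := exists_neighbors_not_cographColorable (not_containsInduced_compl hG')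
      (fun h => hxS (by simpa using h.compl))
    obtain ⟨a, b, hab⟩ := ih _ (fun h => hyS h.compl)
    exact ⟨_, _, hab.cons (fun z hz => hz.1.1) hx hy.1 hy.2 (fun z hz => hz.1.2)
      (fun z hz => ((SimpleGraph.compl_adj _ _ _).1 hz.2).2)⟩

theorem CographOn.isCograph_induce {S : Set V} (h : CographOn G S) : IsCograph (G.induce S) := by
  rintro ⟨f, -, hf⟩
  refine h (f 0) (f 0).2 (f 1) (f 1).2 (f 2) (f 2).2 (f 3) (f 3).2 ?_ ?_ ?_ ?_ ?_ ?_
  · exact (hf 0 1 (by decide)).2 (by simp [pathG])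
  · exact (hf 1 2 (by decide)).2 (by simp [pathG])
  · exact (hf 2 3 (by decide)).2 (by simp [pathG])
  · exact fun h => absurd ((hf 0 2 (by decide)).1 h) (by simp [pathG])
  · exact fun h => absurd ((hf 1 3 (by decide)).1 h) (by simp [pathG])
  · exact fun h => absurd ((hf 0 3 (by decide)).1 h) (by simp [pathG])

end

theorem stmt0 (t k : ℕ) (ht : 1 ≤ t) (hk : 1 ≤ k) :
    ∃ N : ℕ, ∀ (V : Type) (_ : Fintype V) (G : SimpleGraph V),
      ¬ ContainsInduced (pathG t) G →
      ¬ ContainsInduced (pathG t)ᶜ G →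
      ¬ ContainsInduced (Rgraph k) G →
      ∃ c : V → Fin N, ∀ i : Fin N, IsCograph (G.induce (c ⁻¹' {i})) := by
  refine ⟨cographBound t k, fun V _ G hG hG' hR => ?_⟩
  have hcol : CographColorable G Set.univ (cographBound t k) := by
    by_contra hn
    obtain ⟨a, b, hab⟩ := exists_isThresholdIn hG hG' k _ hn
    exact hR hab.containsInduced
  obtain ⟨c, hc, hco⟩ := hcol
  refine ⟨fun v => ⟨c v, hc v trivial⟩, fun i => ((hco i).mono fun v hv => ?_).isCograph_induce⟩
  exact ⟨trivial, congrArg Fin.val hv⟩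
end

section
/- For every pair of integers t, k ≥ 1 there exists an integer N such that the following holds: every finite simple graph G that contains none of P_t, \tilde{P_t}, and H_k as a semi-induced subgraph admits a partition 𝒫 of its vertex set into at most N parts such that (i) for every part A ∈ 𝒫, the subgraph of G induced by A has no induced P_4, and (ii) for every pair of distinct parts A, B ∈ 𝒫 there exists a simple graph H on vertex set A ∪ B with no induced P_4 such that for every a ∈ A and b ∈ B, a and b are adjacent in H iff they are adjacent in G. (This is the size part of Theorem 3; the height bounds are omitted, and 'G[A,B] is a bi-cograph' is expressed as being a semi-induced subgraph of a cograph.) -/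
/-- The bipartite graph `K` (sides `X`, `Y`, adjacency relation `K : X → Y → Prop`)
appears as a semi-induced subgraph of `G`. -/
def SemiInduced {X Y V : Type*} (K : X → Y → Prop) (G : SimpleGraph V) : Prop :=
  ∃ (f : X → V) (g : Y → V),
    Function.Injective f ∧ Function.Injective g ∧
    (∀ x y, f x ≠ g y) ∧
    (∀ x y, G.Adj (f x) (g y) ↔ K x y)

/-- The path `P_t` viewed as a bipartite graph: the sides consist of the
even-indexed and the odd-indexed vertices (0-based indexing), and an even-indexed
vertex is adjacent to an odd-indexed one iff their indices differ by 1. -/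
def pathBipRel (t : ℕ) :
    {i : Fin t // i.val % 2 = 0} → {i : Fin t // i.val % 2 = 1} → Prop :=
  fun x y => x.val.val + 1 = y.val.val ∨ y.val.val + 1 = x.val.val

/-- The half-graph `H_k` as a bipartite graph: `a_i` adjacent to `b_j` iff `i ≤ j`. -/
def halfRel (k : ℕ) : Fin k → Fin k → Prop := fun i j => i ≤ j

namespace CographPartition

open Set

variable {V : Type}

/-! ### Cographs -/

theorem pathG_four_adj (u v : Fin 4) :
    (pathG 4).Adj u v ↔ (u : ℕ) + 1 = v ∨ (v : ℕ) + 1 = u := by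
  simp only [pathG, SimpleGraph.fromRel_adj]
  constructor
  · rintro ⟨-, h⟩
    exact h
  · intro h
    refine ⟨fun e => ?_, h⟩
    subst e
    omega

theorem isCograph_compl {H : SimpleGraph V} (hH : IsCograph H) : IsCograph Hᶜ := by
  rintro ⟨f, hf, h⟩
  have hinj : Function.Injective (![2, 0, 3, 1] : Fin 4 → Fin 4) := by decide
  refine hH ⟨f ∘ ![2, 0, 3, 1], hf.comp hinj, fun u v huv => ?_⟩
  have hne := hinj.ne huv
  have h1 := h _ _ hne
  rw [SimpleGraph.compl_adj, pathG_four_adj] at h1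
  have h2 : f (![2, 0, 3, 1] u) ≠ f (![2, 0, 3, 1] v) := hf.ne hne
  rw [pathG_four_adj, Function.comp_apply, Function.comp_apply]
  have h3 : H.Adj (f (![2, 0, 3, 1] u)) (f (![2, 0, 3, 1] v)) ↔
      ¬ (((![2, 0, 3, 1] u : Fin 4) : ℕ) + 1 = (![2, 0, 3, 1] v : Fin 4) ∨
        ((![2, 0, 3, 1] v : Fin 4) : ℕ) + 1 = (![2, 0, 3, 1] u : Fin 4)) := by
    tauto
  rw [h3]
  clear h3 h1 h2 hne
  revert u v
  decide

theorem isCograph_bot : IsCograph (⊥ : SimpleGraph V) := by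
  rintro ⟨f, -, h⟩
  have := (h 0 1 (by decide)).2 ((pathG_four_adj _ _).2 (by decide))
  exact this

/-- Gluing cographs along the classes of a labelling yields a cograph. -/
theorem isCograph_labelled {L : Type} (l : V → L) (H : L → SimpleGraph V)
    (hH : ∀ a, IsCograph (H a)) :
    ∃ K : SimpleGraph V, IsCograph K ∧ ∀ a b, K.Adj a b ↔ l a = l b ∧ (H (l a)).Adj a b := by
  refine ⟨⟨fun a b => l a = l b ∧ (H (l a)).Adj a b, ?_, ?_⟩, ?_, fun a b => Iff.rfl⟩
  · constructor
    rintro a b ⟨h1, h2⟩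
    exact ⟨h1.symm, h1 ▸ h2.symm⟩
  · constructor
    rintro a ⟨-, h⟩
    exact (H (l a)).loopless.irrefl a h
  · rintro ⟨f, hf, h⟩
    have h01 := ((h 0 1 (by decide)).2 ((pathG_four_adj _ _).2 (by decide))).1
    have h12 := ((h 1 2 (by decide)).2 ((pathG_four_adj _ _).2 (by decide))).1
    have h23 := ((h 2 3 (by decide)).2 ((pathG_four_adj _ _).2 (by decide))).1
    have hl : ∀ u, l (f u) = l (f 0) := by
      intro u
      fin_cases u
      · rfl
      · exact h01.symm
      · exact (h01.trans h12).symm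
      · exact (h01.trans (h12.trans h23)).symm
    refine hH (l (f 0)) ⟨f, hf, fun u v huv => ?_⟩
    rw [← h u v huv]
    change _ ↔ l (f u) = l (f v) ∧ (H (l (f u))).Adj (f u) (f v)
    rw [hl u, hl v]
    simp

/-! ### Bi-cographs and bi-cograph colourings -/

/-- `G` agrees on `X × Y` with a cograph. -/
def BiCograph (G : SimpleGraph V) (X Y : Set V) : Prop :=
  ∃ H : SimpleGraph V, IsCograph H ∧ ∀ a ∈ X, ∀ b ∈ Y, (H.Adj a b ↔ G.Adj a b)

theorem BiCograph.mono {G : SimpleGraph V} {X Y X' Y' : Set V} (h : BiCograph G X Y)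
    (hX : X' ⊆ X) (hY : Y' ⊆ Y) : BiCograph G X' Y' := by
  obtain ⟨H, hH, h⟩ := h
  exact ⟨H, hH, fun a ha b hb => h a (hX ha) b (hY hb)⟩

theorem BiCograph.symm {G : SimpleGraph V} {X Y : Set V} (h : BiCograph G X Y) :
    BiCograph G Y X := by
  obtain ⟨H, hH, h⟩ := h
  refine ⟨H, hH, fun a ha b hb => ?_⟩
  rw [H.adj_comm, G.adj_comm]
  exact h b hb a ha

theorem BiCograph.compl {G : SimpleGraph V} {X Y : Set V} (h : BiCograph G X Y) :
    BiCograph Gᶜ X Y := by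
  obtain ⟨H, hH, h⟩ := h
  refine ⟨Hᶜ, isCograph_compl hH, fun a ha b hb => ?_⟩
  rw [SimpleGraph.compl_adj, SimpleGraph.compl_adj, h a ha b hb]

theorem BiCograph.of_labelled {L : Type} {G : SimpleGraph V} {X Y : Set V} (l : V → L)
    (hl : ∀ a ∈ X, ∀ b ∈ Y, G.Adj a b → l a = l b)
    (h : ∀ c, BiCograph G (X ∩ l ⁻¹' {c}) (Y ∩ l ⁻¹' {c})) : BiCograph G X Y := by
  choose H hH hadj using h
  obtain ⟨K, hK, hKadj⟩ := isCograph_labelled l H hH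
  refine ⟨K, hK, fun a ha b hb => ?_⟩
  rw [hKadj]
  constructor
  · rintro ⟨e, h⟩
    exact (hadj (l a) a ⟨ha, rfl⟩ b ⟨hb, e.symm⟩).1 h
  · intro h
    have e := hl a ha b hb h
    exact ⟨e, (hadj (l a) a ⟨ha, rfl⟩ b ⟨hb, e.symm⟩).2 h⟩

/-- The vertices can be coloured with `N` colours so that every colour class of `X` and
every colour class of `Y` form a bi-cograph. -/
def Colourable (G : SimpleGraph V) (N : ℕ) (X Y : Set V) : Prop :=
  ∃ c : V → Fin N, ∀ i j, BiCograph G (X ∩ c ⁻¹' {i}) (Y ∩ c ⁻¹' {j})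

theorem Colourable.of_fintype {G : SimpleGraph V} {X Y : Set V} {C : Type*} [Fintype C]
    (c : V → C) (h : ∀ i j, BiCograph G (X ∩ c ⁻¹' {i}) (Y ∩ c ⁻¹' {j})) :
    Colourable G (Fintype.card C) X Y := by
  refine ⟨fun v => Fintype.equivFin C (c v), fun i j => ?_⟩
  refine (h ((Fintype.equivFin C).symm i) ((Fintype.equivFin C).symm j)).mono ?_ ?_ <;>
  · rintro v ⟨hv, e⟩
    refine ⟨hv, ?_⟩
    simp only [mem_preimage, mem_singleton_iff] at e ⊢
    rw [← e, Equiv.symm_apply_apply]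

theorem Colourable.mono_card {G : SimpleGraph V} {X Y : Set V} {N M : ℕ}
    (h : Colourable G N X Y) (hNM : N ≤ M) : Colourable G M X Y := by
  obtain ⟨c, hc⟩ := h
  refine ⟨fun v => Fin.castLE hNM (c v), fun i j => ?_⟩
  by_cases hi : (i : ℕ) < N
  · by_cases hj : (j : ℕ) < N
    · refine (hc ⟨i, hi⟩ ⟨j, hj⟩).mono ?_ ?_ <;>
      · rintro v ⟨hv, e⟩
        refine ⟨hv, ?_⟩
        have e' : Fin.castLE hNM (c v) = _ := e
        exact Fin.ext (congrArg Fin.val e' :)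
    · refine ⟨⊥, isCograph_bot, fun a _ b hb => absurd (c b).2 ?_⟩
      have : Fin.castLE hNM (c b) = j := hb.2
      rw [← this] at hj
      simp at hj
  · refine ⟨⊥, isCograph_bot, fun a ha b _ => absurd (c a).2 ?_⟩
    have : Fin.castLE hNM (c a) = i := ha.2
    rw [← this] at hi
    simp at hi

theorem Colourable.symm {G : SimpleGraph V} {X Y : Set V} {N : ℕ}
    (h : Colourable G N X Y) : Colourable G N Y X := by
  obtain ⟨c, hc⟩ := h
  exact ⟨c, fun i j => (hc j i).symm⟩

theorem Colourable.compl {G : SimpleGraph V} {X Y : Set V} {N : ℕ}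
    (h : Colourable G N X Y) : Colourable Gᶜ N X Y := by
  obtain ⟨c, hc⟩ := h
  exact ⟨c, fun i j => (hc i j).compl⟩

theorem Colourable.of_compl {G : SimpleGraph V} {X Y : Set V} {N : ℕ}
    (h : Colourable Gᶜ N X Y) : Colourable G N X Y := by
  simpa using h.compl

theorem Colourable.of_classes {G : SimpleGraph V} {X Y : Set V} {N : ℕ} {C : Type}
    [Fintype C] [DecidableEq C] (q : V → C)
    (h : ∀ i j, Colourable G N (X ∩ q ⁻¹' {i}) (Y ∩ q ⁻¹' {j})) :
    Colourable G (Fintype.card (C × (C × C → Fin N))) X Y := by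
  choose c hc using h
  refine Colourable.of_fintype (fun v => (q v, fun p : C × C => c p.1 p.2 v)) ?_
  rintro ⟨i, f⟩ ⟨j, g⟩
  refine (hc i j (f (i, j)) (g (i, j))).mono ?_ ?_ <;>
  · rintro v ⟨hv, e⟩
    obtain ⟨e1, e2⟩ := Prod.mk.inj e
    exact ⟨⟨hv, e1⟩, congrFun e2 (i, j)⟩

theorem Colourable.of_labelled {L : Type} {G : SimpleGraph V} {X Y : Set V} {N : ℕ} (l : V → L)
    (hl : ∀ a ∈ X, ∀ b ∈ Y, G.Adj a b → l a = l b)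
    (h : ∀ c, Colourable G N (X ∩ l ⁻¹' {c}) (Y ∩ l ⁻¹' {c})) : Colourable G N X Y := by
  choose c hc using h
  refine ⟨fun v => c (l v) v, fun i j => ?_⟩
  refine BiCograph.of_labelled l (fun a ha b hb => hl a ha.1 b hb.1) fun d => ?_
  refine (hc d i j).mono ?_ ?_ <;>
  · rintro v ⟨⟨hv, e⟩, rfl⟩
    exact ⟨⟨hv, rfl⟩, e⟩

/-- If every vertex is complete or anticomplete to `X`, two colours suffice. -/
theorem Colourable.of_homogeneous {G : SimpleGraph V} {X Y : Set V}
    (h : ∀ v, (∀ x ∈ X, ¬ G.Adj v x) ∨ (∀ x ∈ X, ¬ Gᶜ.Adj v x)) : Colourable G 2 X Y := by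
  classical
  have key : Colourable G (Fintype.card Bool) X Y := by
    refine Colourable.of_fintype (fun v => decide (∀ x ∈ X, ¬ G.Adj v x)) fun i j => ?_
    cases j
    · refine ⟨⊥ᶜ, isCograph_compl isCograph_bot, fun a ha b hb => ?_⟩
      have hb' : ¬ ∀ x ∈ X, ¬ G.Adj b x := by simpa using hb.2
      have hab := (h b).resolve_left hb' a ha.1
      rw [SimpleGraph.compl_adj] at hab
      simp only [compl_bot, SimpleGraph.top_adj]
      constructor
      · intro hne
        by_contra hcon
        exact hab ⟨hne.symm, fun h => hcon h.symm⟩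
      · exact fun h => h.ne
    · refine ⟨⊥, isCograph_bot, fun a ha b hb => ?_⟩
      have hb' : ∀ x ∈ X, ¬ G.Adj b x := by simpa using hb.2
      simp only [SimpleGraph.bot_adj, false_iff]
      exact fun h => hb' a ha.1 h.symm
  simpa using key

/-! ### Alternating chains and the splitting rank -/

/-- A sequence of `n` vertices, taken alternately from `Y` and `X`, that are alternately
complete and anticomplete to what remains of the other side. -/
def AltChain : ℕ → SimpleGraph V → Set V → Set V → Prop
  | 0, _, _, _ => True
  | n + 1, G, X, Y => ∃ u ∈ Y, AltChain n Gᶜ Y (X ∩ G.neighborSet u)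

theorem AltChain.mono {n : ℕ} : ∀ {G : SimpleGraph V} {X Y X' Y' : Set V},
    AltChain n G X Y → X ⊆ X' → Y ⊆ Y' → AltChain n G X' Y' := by
  induction n with
  | zero => intros; trivial
  | succ n ih =>
    rintro G X Y X' Y' ⟨u, hu, h⟩ hX hY
    exact ⟨u, hY hu, ih h hY (inter_subset_inter_left _ hX)⟩

theorem AltChain.of_succ {n : ℕ} : ∀ {G : SimpleGraph V} {X Y : Set V},
    AltChain (n + 1) G X Y → AltChain n G X Y := by
  induction n with
  | zero => intros; trivial
  | succ n ih =>
    rintro G X Y ⟨u, hu, h⟩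
    exact ⟨u, hu, ih h⟩

theorem AltChain.exists_halfGraph {k : ℕ} : ∀ {G : SimpleGraph V} {X Y : Set V},
    AltChain (2 * k) G X Y → ∃ u v : Fin k → V, (∀ i, u i ∈ Y) ∧ (∀ i, v i ∈ X) ∧
      (∀ i j, i ≤ j → G.Adj (u i) (v j)) ∧ (∀ i j, j < i → Gᶜ.Adj (v j) (u i)) := by
  induction k with
  | zero => intro G X Y _; exact ⟨Fin.elim0, Fin.elim0, nofun, nofun, nofun, nofun⟩
  | succ k ih =>
    rintro G X Y ⟨a, ha, b, hb, h⟩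
    change AltChain (2 * k) _ _ _ at h
    rw [compl_compl] at h
    obtain ⟨u, v, hu, hv, h1, h2⟩ := ih h
    refine ⟨Fin.cons a u, Fin.cons b v, ?_, ?_, ?_, ?_⟩
    · intro i
      cases i using Fin.cases with
      | zero => exact ha
      | succ i => exact (hu i).1
    · intro i
      cases i using Fin.cases with
      | zero => exact hb.1
      | succ i => exact (hv i).1
    · intro i j hij
      cases i using Fin.cases with
      | zero =>
        cases j using Fin.cases with
        | zero => exact hb.2
        | succ j => exact (hv j).2
      | succ i =>
        cases j using Fin.cases with
        | zero => simp at hij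
        | succ j => exact h1 i j (Fin.succ_le_succ_iff.1 hij)
    · intro i j hij
      cases i using Fin.cases with
      | zero => simp at hij
      | succ i =>
        cases j using Fin.cases with
        | zero => exact (hu i).2
        | succ j => exact h2 i j (Fin.succ_lt_succ_iff.1 hij)

theorem AltChain.semiInduced {k : ℕ} {G : SimpleGraph V} {X Y : Set V}
    (h : AltChain (2 * k) G X Y) : SemiInduced (halfRel k) G := by
  obtain ⟨u, v, -, -, h1, h2⟩ := h.exists_halfGraph
  have key : ∀ i j, G.Adj (u i) (v j) ↔ i ≤ j := fun i j =>
    ⟨fun h => not_lt.1 fun hlt =>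
      ((SimpleGraph.compl_adj _ _ _).1 (h2 i j hlt)).2 h.symm, h1 i j⟩
  refine ⟨u, v, fun i i' e => ?_, fun j j' e => ?_, fun i j e => ?_, key⟩
  · refine le_antisymm ((key i i').1 ?_) ((key i' i).1 ?_)
    · rw [e]; exact h1 i' i' le_rfl
    · rw [← e]; exact h1 i i le_rfl
  · refine le_antisymm ((key j j').1 ?_) ((key j' j).1 ?_)
    · rw [← e]; exact h1 j j le_rfl
    · rw [e]; exact h1 j' j' le_rfl
  · rcases le_or_gt i j with hij | hij
    · exact (h1 i j hij).ne e
    · exact (h2 i j hij).ne e.symm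

/-- `Y` carries a complete binary tree of depth `n` whose inner nodes are vertices of `U`
splitting the current set into neighbours and non-neighbours. -/
def Splits (G : SimpleGraph V) (U : Set V) : ℕ → Set V → Prop
  | 0, Y => Y.Nonempty
  | n + 1, Y => ∃ u ∈ U, Splits G U n (Y ∩ G.neighborSet u) ∧ Splits G U n (Y ∩ Gᶜ.neighborSet u)

theorem Splits.mono {G : SimpleGraph V} {U U' : Set V} {n : ℕ} : ∀ {Y Y' : Set V},
    Splits G U n Y → U ⊆ U' → Y ⊆ Y' → Splits G U' n Y' := by
  induction n with
  | zero => exact fun h _ hY => Set.Nonempty.mono hY h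
  | succ n ih =>
    rintro Y Y' ⟨u, hu, h1, h2⟩ hU hY
    exact ⟨u, hU hu, ih h1 hU (inter_subset_inter_left _ hY),
      ih h2 hU (inter_subset_inter_left _ hY)⟩

theorem Splits.nonempty {G : SimpleGraph V} {U : Set V} {n : ℕ} : ∀ {Y : Set V},
    Splits G U n Y → Y.Nonempty := by
  induction n with
  | zero => exact fun h => h
  | succ n ih =>
    rintro Y ⟨u, -, h1, -⟩
    exact (ih h1).mono inter_subset_left

theorem Splits.compl {G : SimpleGraph V} {U : Set V} {n : ℕ} : ∀ {Y : Set V},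
    Splits G U n Y → Splits Gᶜ U n Y := by
  induction n with
  | zero => exact fun h => h
  | succ n ih =>
    rintro Y ⟨u, hu, h1, h2⟩
    exact ⟨u, hu, ih h2, by rw [compl_compl]; exact ih h1⟩

theorem Splits.of_compl {G : SimpleGraph V} {U : Set V} {n : ℕ} {Y : Set V}
    (h : Splits Gᶜ U n Y) : Splits G U n Y := by
  simpa using h.compl

theorem Splits.union {G : SimpleGraph V} {U W : Set V} : ∀ {s m n : ℕ}, m + n = s →
    ∀ {Y : Set V}, Splits G (U ∪ W) s Y → Splits G U m Y ∨ Splits G W n Y := by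
  intro s
  induction s with
  | zero =>
    intro m n hmn Y h
    obtain rfl : m = 0 := by omega
    exact Or.inl h
  | succ s ih =>
    intro m n hmn Y h
    rcases m with _ | m
    · exact Or.inl h.nonempty
    rcases n with _ | n
    · exact Or.inr h.nonempty
    obtain ⟨u, hu | hu, h1, h2⟩ := h
    · rcases ih (m := m) (n := n + 1) (by omega) h1 with h1 | h1
      · rcases ih (m := m) (n := n + 1) (by omega) h2 with h2 | h2
        · exact Or.inl ⟨u, hu, h1, h2⟩
        · exact Or.inr (h2.mono subset_rfl inter_subset_left)
      · exact Or.inr (h1.mono subset_rfl inter_subset_left)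
    · rcases ih (m := m + 1) (n := n) (by omega) h1 with h1 | h1
      · exact Or.inl (h1.mono subset_rfl inter_subset_left)
      · rcases ih (m := m + 1) (n := n) (by omega) h2 with h2 | h2
        · exact Or.inl (h2.mono subset_rfl inter_subset_left)
        · exact Or.inr ⟨u, hu, h1, h2⟩

theorem not_splits_singleton {G : SimpleGraph V} {h : V} {Y : Set V} : ¬ Splits G {h} 2 Y := by
  rintro ⟨u, rfl, ⟨v, rfl, -, hne⟩, -⟩
  obtain ⟨x, hx⟩ := hne
  exact ((SimpleGraph.compl_adj _ _ _).1 hx.2).2 hx.1.2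

theorem AltChain.of_splits {G : SimpleGraph V} {U Y : Set V} {n r : ℕ} {h : V} (hY : h ∈ Y)
    (hs : Splits G (U ∩ G.neighborSet h) (r + 1) Y)
    (ih : ∀ Y' ⊆ Y, Splits G (U ∩ G.neighborSet h) r Y' → AltChain n G (U ∩ G.neighborSet h) Y') :
    AltChain (n + 2) G U Y := by
  obtain ⟨u, hu, -, h2⟩ := hs
  refine ⟨h, hY, u, hu, ?_⟩
  rw [compl_compl]
  exact ih _ inter_subset_left h2

/-- Large splitting rank forces a long alternating chain in the graph or its complement. -/
theorem exists_altChain_of_splits (s : ℕ) : ∃ r : ℕ, ∀ p q : ℕ, p + q = s →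
    ∀ (V : Type) (G : SimpleGraph V) (U Y : Set V), Splits G U r Y →
      AltChain (2 * p) G U Y ∨ AltChain (2 * q) Gᶜ U Y := by
  induction s with
  | zero =>
    refine ⟨0, fun p q hpq V G U Y _ => Or.inl ?_⟩
    obtain rfl : p = 0 := by omega
    trivial
  | succ s ih =>
    obtain ⟨r, ih⟩ := ih
    refine ⟨(r + 1) + ((r + 1) + 2), fun p q hpq V G U Y h => ?_⟩
    rcases p with _ | p
    · exact Or.inl trivial
    rcases q with _ | q
    · exact Or.inr trivial
    obtain ⟨x, hx⟩ := h.nonempty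
    have hU : U ⊆ (U ∩ G.neighborSet x) ∪ ((U ∩ Gᶜ.neighborSet x) ∪ {x}) := by
      intro u hu
      by_cases h1 : G.Adj x u
      · exact Or.inl ⟨hu, h1⟩
      · by_cases h2 : x = u
        · exact Or.inr (Or.inr h2.symm)
        · exact Or.inr (Or.inl ⟨hu, (SimpleGraph.compl_adj _ _ _).2 ⟨h2, h1⟩⟩)
    have h' := h.mono hU subset_rfl
    rcases h'.union rfl with h1 | h1
    · by_cases hc : AltChain (2 * (q + 1)) Gᶜ U Y
      · exact Or.inr hc
      refine Or.inl (AltChain.of_splits hx h1 fun Y' hY' hs => ?_)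
      refine (ih p (q + 1) (by omega) V G _ _ hs).resolve_right fun hc' => ?_
      exact hc (hc'.mono inter_subset_left hY')
    · rcases h1.union rfl with h1 | h1
      · by_cases hc : AltChain (2 * (p + 1)) G U Y
        · exact Or.inl hc
        refine Or.inr (AltChain.of_splits hx h1.compl fun Y' hY' hs => ?_)
        refine (ih (p + 1) q (by omega) V G _ _ hs.of_compl).resolve_left fun hc' => ?_
        exact hc (hc'.mono inter_subset_left hY')
      · exact absurd h1 not_splits_singleton

/-! ### Induced paths -/

/-- The edges of `G` with one end in `X` and the other in `Y`. -/
def crossGraph (G : SimpleGraph V) (X Y : Set V) : SimpleGraph V where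
  Adj a b := G.Adj a b ∧ ((a ∈ X ∧ b ∈ Y) ∨ (a ∈ Y ∧ b ∈ X))
  symm := ⟨fun _ _ h => ⟨h.1.symm, h.2.symm.imp And.symm And.symm⟩⟩
  loopless := ⟨fun _ h => h.1.ne rfl⟩

theorem crossGraph_mem_right {G : SimpleGraph V} {X Y : Set V} (hXY : X = Y ∨ Disjoint X Y)
    {a b : V} (h : (crossGraph G X Y).Adj a b) (ha : a ∈ X) : b ∈ Y := by
  rcases h.2 with h | h
  · exact h.2
  · rcases hXY with rfl | hd
    · exact h.2
    · exact absurd h.1 (disjoint_left.1 hd ha)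

theorem crossGraph_mem_left {G : SimpleGraph V} {X Y : Set V} (hXY : X = Y ∨ Disjoint X Y)
    {a b : V} (h : (crossGraph G X Y).Adj a b) (ha : a ∈ Y) : b ∈ X := by
  rcases h.2 with h | h
  · rcases hXY with rfl | hd
    · exact h.2
    · exact absurd ha (disjoint_left.1 hd h.1)
  · exact h.2

/-- The list enumerates an induced path of `B`. -/
def InducedPath (B : SimpleGraph V) : List V → Prop
  | [] => True
  | a :: l => a ∉ l ∧ InducedPath B l ∧ ∀ b ∈ l, (B.Adj a b ↔ l.head? = some b)

theorem InducedPath.getElem {B : SimpleGraph V} : ∀ {l : List V}, InducedPath B l →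
    ∀ (i j : ℕ) (hi : i < l.length) (hj : j < l.length), i < j →
      l[i] ≠ l[j] ∧ (B.Adj l[i] l[j] ↔ j = i + 1) := by
  intro l
  induction l with
  | nil => intro _ i j hi; simp at hi
  | cons a l ih =>
    rintro ⟨ha, hl, hadj⟩ i j hi hj hij
    obtain ⟨j, rfl⟩ : ∃ j', j = j' + 1 := ⟨j - 1, by omega⟩
    have hj' : j < l.length := by simpa using hj
    rcases i with _ | i
    · simp only [List.getElem_cons_zero, List.getElem_cons_succ]
      refine ⟨fun e => ha (e ▸ List.getElem_mem hj'), ?_⟩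
      rw [hadj _ (List.getElem_mem hj'), List.head?_eq_getElem?]
      rw [List.getElem?_eq_getElem (by omega), Option.some_inj]
      constructor
      · intro e
        by_contra hne
        exact (ih hl 0 j (by omega) hj' (by omega)).1 e
      · intro e
        obtain rfl : j = 0 := by omega
        rfl
    · simp only [List.getElem_cons_succ]
      have := ih hl i j (by omega) hj' (by omega)
      refine ⟨this.1, this.2.trans ?_⟩
      omega

/-- A path that is induced among the edges between `X` and `Y` is semi-induced. -/
theorem InducedPath.semiInduced {G : SimpleGraph V} {X Y : Set V} (hXY : X = Y ∨ Disjoint X Y)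
    {l : List V} (h : InducedPath (crossGraph G X Y) l) :
    SemiInduced (pathBipRel l.length) G := by
  have hinj : ∀ i j : Fin l.length, l[i] = l[j] → i = j := by
    intro i j e
    rcases lt_trichotomy i j with hij | hij | hij
    · exact absurd e (h.getElem i j i.2 j.2 hij).1
    · exact hij
    · exact absurd e.symm (h.getElem j i j.2 i.2 hij).1
  have hcross : ∀ i j : Fin l.length,
      (crossGraph G X Y).Adj l[i] l[j] ↔ (i : ℕ) + 1 = j ∨ (j : ℕ) + 1 = i := by
    intro i j
    rcases lt_trichotomy i j with hij | hij | hij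
    · have := (h.getElem i j i.2 j.2 hij).2
      rw [Fin.lt_def] at hij
      refine this.trans ?_
      omega
    · subst hij
      simp
    · have := (h.getElem j i j.2 i.2 hij).2
      rw [Fin.lt_def] at hij
      rw [SimpleGraph.adj_comm]
      refine this.trans ?_
      omega
  have hstep : ∀ i (hi : i + 1 < l.length), (crossGraph G X Y).Adj l[i] l[i + 1] := fun i hi =>
    (hcross ⟨i, by omega⟩ ⟨i + 1, hi⟩).2 (Or.inl rfl)
  have hsides : ∀ h1 : 1 < l.length,
      (∀ i (hi : i < l.length), if i % 2 = 0 then l[i] ∈ X else l[i] ∈ Y) ∨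
      (∀ i (hi : i < l.length), if i % 2 = 0 then l[i] ∈ Y else l[i] ∈ X) := by
    intro h1
    refine (hstep 0 h1).2.imp (fun h0 i => ?_) (fun h0 i => ?_)
    all_goals
      induction i with
      | zero => intro hi; simpa using h0.1
      | succ i ih =>
        intro hi
        have h2 := ih (by omega)
        have h3 := hstep i hi
        split_ifs at h2 ⊢ with h4 h5 h6
        · omega
        · first
            | exact crossGraph_mem_right hXY h3 h2
            | exact crossGraph_mem_left hXY h3 h2
        · first
            | exact crossGraph_mem_left hXY h3 h2
            | exact crossGraph_mem_right hXY h3 h2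
        · omega
  refine ⟨fun i => l[i.1], fun j => l[j.1], fun i j e => Subtype.ext (hinj _ _ e),
    fun i j e => Subtype.ext (hinj _ _ e), fun i j e => ?_, fun i j => ?_⟩
  · have := hinj _ _ e
    have h1 := i.2
    have h2 := j.2
    rw [this] at h1
    omega
  · change _ ↔ (i.1 : ℕ) + 1 = j.1 ∨ (j.1 : ℕ) + 1 = i.1
    rw [← hcross]
    have hi := i.2
    have hj := j.2
    have hlt := j.1.2
    have hs := hsides (by omega)
    constructor
    · intro hadj
      refine ⟨hadj, hs.imp (fun hs => ?_) (fun hs => ?_)⟩ <;>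
      · have h1 := hs i.1 i.1.2
        have h2 := hs j.1 j.1.2
        rw [if_pos hi] at h1
        rw [if_neg (by omega)] at h2
        exact ⟨h1, h2⟩
    · exact fun h => h.1

/-! ### Gyárfás layerings -/

/-- The connected component of `x` in the subgraph of `B` induced by `T`. -/
def component (B : SimpleGraph V) (T : Set V) (x : V) :
    Quot (fun a b => a ∈ T ∧ b ∈ T ∧ B.Adj a b) :=
  Quot.mk _ x

theorem component_eq_of_adj {B : SimpleGraph V} {T : Set V} {x y : V} (hx : x ∈ T) (hy : y ∈ T)
    (h : B.Adj x y) : component B T x = component B T y :=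
  Quot.sound ⟨hx, hy, h⟩

theorem eq_of_component_eq {B : SimpleGraph V} {T : Set V} {x y : V} {S : Type} {f : V → S}
    (hf : ∀ a ∈ T, ∀ b ∈ T, B.Adj a b → f a = f b)
    (h : component B T x = component B T y) : f x = f y :=
  congrArg (Quot.lift f fun a b hab => hf a hab.1 b hab.2.1 hab.2.2) h

/-- If every component of `B[T]` meets `K`, then for every component of `B[T \ K]` one can
choose a vertex of `T ∩ K` with a neighbour in it. -/
theorem exists_attachment {B : SimpleGraph V} {T K : Set V}
    (hK : ∀ x ∈ T, ∃ z ∈ T ∩ K, component B T z = component B T x) :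
    ∃ f : V → V, (∀ x ∈ T \ K, f x ∈ T ∩ K ∧ component B T (f x) = component B T x ∧
        ∃ y ∈ T \ K, component B (T \ K) y = component B (T \ K) x ∧ B.Adj (f x) y) ∧
      ∀ x ∈ T \ K, ∀ y ∈ T \ K, B.Adj x y → f x = f y := by
  classical
  let D : V → V → Prop := fun x p => p ∈ T ∩ K ∧
    ∃ y ∈ T \ K, component B (T \ K) y = component B (T \ K) x ∧ B.Adj p y
  have hD : ∀ x ∈ T \ K, ∀ y ∈ T \ K, B.Adj x y → D x = D y := by
    intro x hx y hy hxy
    have := component_eq_of_adj hx hy hxy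
    simp only [D, this]
  have hex : ∀ x ∈ T \ K, ∃ p, D x p := by
    let P : V → Prop := fun x => x ∈ T \ K → ∃ p, D x p
    have hP : ∀ x ∈ T, ∀ y ∈ T, B.Adj x y → P x → P y := by
      intro x hx y hy hxy hPx hyK
      by_cases hxK : x ∈ K
      · exact ⟨x, ⟨hx, hxK⟩, y, hyK, rfl, hxy⟩
      · rw [← hD x ⟨hx, hxK⟩ y hyK hxy]
        exact hPx ⟨hx, hxK⟩
    intro x hx
    obtain ⟨z, hz, e⟩ := hK x hx.1
    have hPz : P z := fun h => absurd hz.2 h.2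
    have : P z = P x := eq_of_component_eq
      (fun a ha b hb hab => propext ⟨hP a ha b hb hab, hP b hb a ha hab.symm⟩) e
    exact (this ▸ hPz) hx
  refine ⟨fun x => if h : ∃ p, D x p then h.choose else x, fun x hx => ?_, fun x hx y hy hxy => ?_⟩
  · have h := hex x hx
    simp only [dif_pos h]
    obtain ⟨h1, y, hy, h2, h3⟩ := h.choose_spec
    refine ⟨h1, ?_, y, hy, h2, h3⟩
    rw [component_eq_of_adj h1.1 hy.1 h3]
    exact eq_of_component_eq (fun a ha b hb hab => component_eq_of_adj ha.1 hb.1 hab) h2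
  · have h := hex x hx
    have h' := hex y hy
    simp only [dif_pos h, dif_pos h']
    have e := hD x hx y hy hxy
    congr 1

theorem exists_layering_of_paths {B : SimpleGraph V} {t : ℕ}
    (ht : ∀ l : List V, InducedPath B l → l.length ≠ t) (n : ℕ) :
    ∀ (T K : Set V) (P : V → List V),
      (∀ x ∈ T, (P x).length + n + 1 = t) →
      (∀ x ∈ T, ∀ y ∈ T, B.Adj x y → P x = P y) →
      (∀ x ∈ T ∩ K, InducedPath B (x :: P x)) →
      (∀ x ∈ T \ K, ∀ b ∈ P x, ¬ B.Adj x b ∧ x ≠ b) →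
      (∀ x ∈ T, ∃ z ∈ T ∩ K, component B T z = component B T x) →
      ∃ (q : V → ℕ) (w : ℕ → V → V),
        (∀ x, q x ≤ n) ∧ (∀ x ∈ T, q x = 0 → x ∈ K) ∧
        (∀ i, ∀ x ∈ T, i + 1 = q x → B.Adj (w i x) x) ∧
        ∀ i, ∀ x ∈ T, ∀ y ∈ T, i < q x → i < q y → B.Adj x y → w i x = w i y := by
  classical
  induction n with
  | zero =>
    intro T K P hlen hP hpath hout hK
    have hT : ∀ x, x ∉ T := by
      intro x hx
      obtain ⟨z, hz, -⟩ := hK x hx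
      exact ht _ (hpath z hz) (by simpa using hlen z hz.1)
    exact ⟨fun _ => 0, fun _ => id, fun x => le_rfl, fun x hx => absurd hx (hT x),
      fun i x hx => absurd hx (hT x), fun i x hx => absurd hx (hT x)⟩
  | succ n ih =>
    intro T K P hlen hP hpath hout hK
    obtain ⟨f, hf, hfadj⟩ := exists_attachment hK
    have hPf : ∀ x ∈ T \ K, P (f x) = P x := fun x hx => eq_of_component_eq hP (hf x hx).2.1
    obtain ⟨q, w, hq, hq0, hw, hwadj⟩ := ih (T \ K) {x | B.Adj (f x) x} (fun x => f x :: P x)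
      (by
        intro x hx
        have := hlen x hx.1
        simp only [List.length_cons]
        omega)
      (by
        intro x hx y hy hxy
        simp only [hfadj x hx y hy hxy, hP x hx.1 y hy.1 hxy])
      (by
        rintro x ⟨hx, hxK : B.Adj (f x) x⟩
        have h1 := hpath (f x) (hf x hx).1
        rw [hPf x hx] at h1
        refine ⟨?_, h1, ?_⟩
        · simp only [List.mem_cons, not_or]
          exact ⟨hxK.ne', fun h => (hout x hx x h).2 rfl⟩
        · intro b hb
          simp only [List.head?_cons, Option.some_inj]
          rcases List.mem_cons.1 hb with rfl | hb
          · simp [hxK.symm]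
          · simp only [(hout x hx b hb).1, false_iff]
            rintro rfl
            exact h1.1 hb)
      (by
        rintro x ⟨hx, hxK⟩ b hb
        rcases List.mem_cons.1 hb with rfl | hb
        · exact ⟨fun h => hxK h.symm, fun e => hx.2 (e ▸ (hf x hx).1.2)⟩
        · exact hout x hx b hb)
      (by
        intro x hx
        obtain ⟨-, -, y, hy, e, hadj⟩ := hf x hx
        refine ⟨y, ⟨hy, ?_⟩, e⟩
        have : f y = f x := eq_of_component_eq hfadj e
        simpa [this] using hadj)
    refine ⟨fun x => if x ∈ K then 0 else q x + 1,
      fun i => match i with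
        | 0 => f
        | i + 1 => w i, fun x => ?_, fun x hx h => ?_, fun i x hx h => ?_,
      fun i x hx y hy hix hiy hxy => ?_⟩
    · dsimp only
      split_ifs
      · omega
      · have := hq x
        omega
    · by_contra hxK
      simp [hxK] at h
    · by_cases hxK : x ∈ K
      · simp [hxK] at h
      · simp only [hxK, if_false] at h
        rcases i with _ | i
        · exact hq0 x ⟨hx, hxK⟩ (by omega)
        · exact hw i x ⟨hx, hxK⟩ (by omega)
    · by_cases hxK : x ∈ K
      · simp [hxK] at hix
      by_cases hyK : y ∈ K
      · simp [hyK] at hiy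
      simp only [hxK, hyK, if_false] at hix hiy
      rcases i with _ | i
      · exact hfadj x ⟨hx, hxK⟩ y ⟨hy, hyK⟩ hxy
      · exact hwadj i x ⟨hx, hxK⟩ y ⟨hy, hyK⟩ (by omega) (by omega) hxy

/-- A graph without induced path on `t` vertices can be split into `t` layers so that, for
each `i`, every component of the layers from `i` on meets layer `i` inside the neighbourhood of
a single vertex; for the first layer this vertex itself is the only one. -/
theorem exists_layering {B : SimpleGraph V} {t : ℕ} (ht1 : 1 ≤ t)
    (ht : ∀ l : List V, InducedPath B l → l.length ≠ t) :
    ∃ (q : V → Fin t) (w : Fin t → V → V),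
      (∀ i, (∀ x, q x = i → w i x = x) ∨ ∀ x, q x = i → B.Adj (w i x) x) ∧
      ∀ i x y, i ≤ q x → i ≤ q y → B.Adj x y → w i x = w i y := by
  let root : V → V := fun x => (component B univ x).out
  have hroot : ∀ x, component B univ (root x) = component B univ x := fun x => Quot.out_eq _
  obtain ⟨q, w, hq, hq0, hw, hwadj⟩ := exists_layering_of_paths ht (t - 1) univ
    {x | root x = x} (fun _ => []) (by intro x _; simp only [List.length_nil]; omega)
    (fun _ _ _ _ _ => rfl)
    (fun _ _ => ⟨List.not_mem_nil, trivial, fun b hb => absurd hb List.not_mem_nil⟩)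
    (fun _ _ b hb => absurd hb List.not_mem_nil)
    (fun x _ => ⟨root x, ⟨mem_univ _, congrArg Quot.out (hroot x)⟩, hroot x⟩)
  refine ⟨fun x => ⟨q x, by have := hq x; omega⟩, fun i => match (i : ℕ) with
        | 0 => root
        | i + 1 => w i, ?_, ?_⟩
  · rintro ⟨i, hi⟩
    rcases i with _ | i
    · exact Or.inl fun x hx => hq0 x (mem_univ x) (Fin.mk.inj hx)
    · exact Or.inr fun x hx => hw i x (mem_univ x) (Fin.mk.inj hx).symm
  · rintro ⟨i, hi⟩ x y hx hy hxy
    rcases i with _ | i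
    · exact congrArg Quot.out (component_eq_of_adj (mem_univ x) (mem_univ y) hxy)
    · exact hwadj i x (mem_univ x) y (mem_univ y) hx hy hxy

/-! ### Colouring pairs of sets -/

theorem eq_or_disjoint_inter {X Y A B : Set V} (h : X = Y ∨ Disjoint X Y)
    (h' : A = B ∨ Disjoint A B) : X ∩ A = Y ∩ B ∨ Disjoint (X ∩ A) (Y ∩ B) := by
  rcases h with rfl | h
  · rcases h' with rfl | h'
    · exact Or.inl rfl
    · exact Or.inr (h'.mono inter_subset_right inter_subset_right)
  · exact Or.inr (h.mono inter_subset_left inter_subset_left)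

theorem eq_or_disjoint_fiber {C : Type} (q : V → C) (i j : C) :
    q ⁻¹' {i} = q ⁻¹' {j} ∨ Disjoint (q ⁻¹' {i}) (q ⁻¹' {j}) := by
  by_cases h : i = j
  · exact Or.inl (h ▸ rfl)
  · exact Or.inr (Disjoint.preimage q (by simpa using h))

/-- Every pair of subsets of `X` and `Y` whose first member lies in the `G'`-neighbourhood of a
vertex of `Y` can be coloured for `G`. -/
def NbhdColourable (G G' : SimpleGraph V) (N : ℕ) (X Y : Set V) : Prop :=
  ∀ X' ⊆ X, ∀ Y' ⊆ Y, (X' = Y' ∨ Disjoint X' Y') → ∀ u ∈ Y, X' ⊆ G'.neighborSet u →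
    Colourable G N X' Y'

theorem NbhdColourable.mono {G G' : SimpleGraph V} {N M : ℕ} {X Y X' Y' : Set V}
    (h : NbhdColourable G G' N X Y) (hX : X' ⊆ X) (hY : Y' ⊆ Y) (hNM : N ≤ M) :
    NbhdColourable G G' M X' Y' := fun _ hX' _ hY' hd u hu hN =>
  (h _ (hX'.trans hX) _ (hY'.trans hY) hd u (hY hu) hN).mono_card hNM

theorem NbhdColourable.compl {G G' : SimpleGraph V} {N : ℕ} {X Y : Set V}
    (h : NbhdColourable G G' N X Y) : NbhdColourable Gᶜ G' N X Y :=
  fun X' hX' Y' hY' hd u hu hN => (h X' hX' Y' hY' hd u hu hN).compl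

theorem NbhdColourable.piece {G : SimpleGraph V} {N : ℕ} (hN : 2 ≤ N) {X Y X' Y' : Set V}
    (h : NbhdColourable G G N X Y) (hXY : X = Y ∨ Disjoint X Y) (hX : X' ⊆ X) (hY : Y' ⊆ Y)
    (hXY' : X' = Y' ∨ Disjoint X' Y') (c : V)
    (hc : (∀ x ∈ X', c = x) ∨ ∀ x ∈ X', (crossGraph G X Y).Adj c x) :
    Colourable G N X' Y' := by
  by_cases hs : X'.Subsingleton
  · refine (Colourable.of_homogeneous fun v => ?_).mono_card hN
    by_cases hv : ∃ x ∈ X', G.Adj v x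
    · obtain ⟨x, hx, hvx⟩ := hv
      refine Or.inr fun y hy hvy => ?_
      rw [← hs hx hy] at hvy
      exact ((SimpleGraph.compl_adj _ _ _).1 hvy).2 hvx
    · exact Or.inl fun x hx hvx => hv ⟨x, hx, hvx⟩
  · obtain ⟨x, hx, -⟩ := not_subsingleton_iff.1 hs
    have hc := hc.resolve_left fun hc => hs fun a ha b hb => (hc a ha).symm.trans (hc b hb)
    exact h X' hX Y' hY hXY' c (crossGraph_mem_right hXY (hc x hx).symm (hX hx))
      fun y hy => (hc y hy).1

theorem crossGraph_comm (G : SimpleGraph V) (X Y : Set V) :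
    crossGraph G X Y = crossGraph G Y X := by
  ext a b
  exact and_congr_right fun _ => or_comm

theorem colourable_of_nbhdColourable {G : SimpleGraph V} {t N : ℕ} (ht : 1 ≤ t) (hN : 2 ≤ N)
    (hG : ¬ SemiInduced (pathBipRel t) G) {X Y : Set V} (hXY : X = Y ∨ Disjoint X Y)
    (hX : NbhdColourable G G N X Y) (hY : NbhdColourable G G N Y X) :
    Colourable G (Fintype.card (Fin t × (Fin t × Fin t → Fin N))) X Y := by
  obtain ⟨q, w, hw, hwadj⟩ := exists_layering (B := crossGraph G X Y) ht fun l hl e =>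
    hG (e ▸ hl.semiInduced hXY)
  refine Colourable.of_classes q fun i j => ?_
  have hfib : ∀ (l : V → V) (c : V), X ∩ q ⁻¹' {i} ∩ l ⁻¹' {c} = Y ∩ q ⁻¹' {j} ∩ l ⁻¹' {c} ∨
      Disjoint (X ∩ q ⁻¹' {i} ∩ l ⁻¹' {c}) (Y ∩ q ⁻¹' {j} ∩ l ⁻¹' {c}) := fun l c =>
    eq_or_disjoint_inter (eq_or_disjoint_inter hXY (eq_or_disjoint_fiber q i j)) (Or.inl rfl)
  have hsub : ∀ (Z : Set V) (k : Fin t) (l : V → V) (c : V),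
      Z ∩ q ⁻¹' {k} ∩ l ⁻¹' {c} ⊆ Z := fun Z k l c x hx => hx.1.1
  rcases le_total i j with hij | hij
  · refine Colourable.of_labelled (w i) (fun a ha b hb hab => ?_) fun c => ?_
    · exact hwadj i a b (ge_of_eq ha.2) (hij.trans (ge_of_eq hb.2))
        ⟨hab, Or.inl ⟨ha.1, hb.1⟩⟩
    · refine hX.piece hN hXY (hsub _ _ _ _) (hsub _ _ _ _) (hfib _ _) c ?_
      refine (hw i).imp (fun h x hx => ?_) (fun h x hx => ?_)
      · exact (hx.2 : w i x = c) ▸ h x hx.1.2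
      · exact (hx.2 : w i x = c) ▸ h x hx.1.2
  · refine Colourable.of_labelled (w j) (fun a ha b hb hab => ?_) fun c => ?_
    · exact hwadj j a b (hij.trans (ge_of_eq ha.2)) (ge_of_eq hb.2)
        ⟨hab, Or.inl ⟨ha.1, hb.1⟩⟩
    · refine (hY.piece hN (hXY.imp Eq.symm fun h => h.symm) (hsub _ _ _ _) (hsub _ _ _ _)
        ((hfib _ _).imp Eq.symm fun h => h.symm) c ?_).symm
      rw [crossGraph_comm G Y X]
      refine (hw j).imp (fun h x hx => ?_) (fun h x hx => ?_)
      · exact (hx.2 : w j x = c) ▸ h x hx.1.2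
      · exact (hx.2 : w j x = c) ▸ h x hx.1.2

/-- A pair whose pieces of one side inside neighbourhoods, and of the other side inside
non-neighbourhoods, are colourable can be coloured as well, if alternating chains are bounded. -/
theorem exists_colourable_of_mixed {t : ℕ} (ht : 1 ≤ t) (N₀ n : ℕ) :
    ∃ N, ∀ (V : Type) (G : SimpleGraph V) (X Y : Set V),
      ¬ SemiInduced (pathBipRel t) G → ¬ SemiInduced (pathBipRel t) Gᶜ →
      (X = Y ∨ Disjoint X Y) → ¬ AltChain n G X Y →
      NbhdColourable G Gᶜ N₀ X Y → NbhdColourable G G N₀ Y X → Colourable G N X Y := by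
  induction n with
  | zero => exact ⟨0, fun V G X Y _ _ _ h => absurd trivial h⟩
  | succ n ih =>
    obtain ⟨N, ih⟩ := ih
    refine ⟨_, fun V G X Y hG hGc hXY hA hX hY =>
      colourable_of_nbhdColourable (N := max 2 (max N₀ N)) ht (by simp) hG hXY ?_
        (hY.mono subset_rfl subset_rfl (by simp))⟩
    intro X' hX' Y' hY' hd u hu hN
    have key : Colourable Gᶜ N Y' X' := by
      refine ih V Gᶜ Y' X' hGc (by rwa [compl_compl]) (hd.imp Eq.symm fun h => h.symm)
        (fun h => hA ⟨u, hu, h.mono hY' (subset_inter hX' hN)⟩) ?_ ?_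
      · rw [compl_compl]
        exact (hY.mono hY' hX' le_rfl).compl
      · exact (hX.mono hX' hY' le_rfl).compl
    exact key.symm.of_compl.mono_card (by simp)

/-- Bounds on paths and on alternating chains, in a graph and its complement. -/
structure Tame (t K : ℕ) (G : SimpleGraph V) : Prop where
  path : ¬ SemiInduced (pathBipRel t) G
  path_compl : ¬ SemiInduced (pathBipRel t) Gᶜ
  chain : ∀ X Y, ¬ AltChain K G X Y
  chain_compl : ∀ X Y, ¬ AltChain K Gᶜ X Y

theorem colourable_of_not_splits_one {G : SimpleGraph V} {X Y : Set V}
    (h : ¬ Splits G univ 1 X) : Colourable G 2 X Y := by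
  refine Colourable.of_homogeneous fun v => ?_
  by_contra! hcon
  obtain ⟨⟨x, hx, hvx⟩, y, hy, hvy⟩ := hcon
  exact h ⟨v, mem_univ v, ⟨x, hx, hvx⟩, y, hy, hvy⟩

theorem exists_colourable_of_not_splits {t : ℕ} (ht : 1 ≤ t) (K s : ℕ) :
    ∃ N, ∀ m n, m + n = s → ∀ (V : Type) (G : SimpleGraph V) (X Y : Set V), Tame t K G →
      (X = Y ∨ Disjoint X Y) → ¬ Splits G univ m X → ¬ Splits G univ n Y →
      Colourable G N X Y := by
  classical
  induction s with
  | zero =>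
    refine ⟨2, fun m n hmn V G X Y _ _ hX _ => colourable_of_not_splits_one fun h => hX ?_⟩
    obtain rfl : m = 0 := by omega
    exact h.nonempty
  | succ s ih =>
    obtain ⟨N₀, ih⟩ := ih
    obtain ⟨N₁, hmix⟩ := exists_colourable_of_mixed ht N₀ K
    let N₂ := Fintype.card (Fin t × (Fin t × Fin t → Fin (max 2 N₀)))
    let N₃ := Fintype.card ((Bool × Bool) × ((Bool × Bool) × (Bool × Bool) → Fin (max N₁ N₂)))
    refine ⟨max 2 N₃, fun m n hmn V G X Y hG hXY hX hY => ?_⟩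
    by_cases hX1 : Splits G univ 1 X
    swap
    · exact (colourable_of_not_splits_one hX1).mono_card (le_max_left _ _)
    by_cases hY1 : Splits G univ 1 Y
    swap
    · exact (colourable_of_not_splits_one hY1).symm.mono_card (le_max_left _ _)
    rcases m with _ | m
    · exact absurd hX1.nonempty hX
    rcases n with _ | n
    · exact absurd hY1.nonempty hY
    refine (Colourable.of_classes (N := max N₁ N₂)
      (fun v => (decide (Splits G univ n (Y ∩ G.neighborSet v)),
        decide (Splits G univ m (X ∩ G.neighborSet v)))) ?_).mono_card (le_max_right _ _)
    rintro ⟨a, a'⟩ ⟨b', b⟩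
    set q : V → Bool × Bool := fun v => (decide (Splits G univ n (Y ∩ G.neighborSet v)),
        decide (Splits G univ m (X ∩ G.neighborSet v))) with hq
    have hd := eq_or_disjoint_inter hXY (eq_or_disjoint_fiber q (a, a') (b', b))
    set A := X ∩ q ⁻¹' {(a, a')}
    set B := Y ∩ q ⁻¹' {(b', b)}
    have hAX : A ⊆ X := inter_subset_left
    have hBY : B ⊆ Y := inter_subset_left
    have hleft : ∀ G' : SimpleGraph V, (∀ u ∈ B, ¬ Splits G univ m (X ∩ G'.neighborSet u)) →
        NbhdColourable G G' N₀ A B := by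
      intro G' h X' hX' Y' hY' hd' u hu hN
      refine ih m (n + 1) (by omega) V G X' Y' hG hd' (fun hs => h u hu ?_) fun hs => hY ?_
      · exact hs.mono subset_rfl (subset_inter (hX'.trans hAX) hN)
      · exact hs.mono subset_rfl (hY'.trans hBY)
    have hright : ∀ G' : SimpleGraph V, (∀ u ∈ A, ¬ Splits G univ n (Y ∩ G'.neighborSet u)) →
        NbhdColourable G G' N₀ B A := by
      intro G' h Y' hY' X' hX' hd' u hu hN
      refine (ih (m + 1) n (by omega) V G X' Y' hG (hd'.imp Eq.symm fun h => h.symm)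
        (fun hs => hX ?_) fun hs => h u hu ?_).symm
      · exact hs.mono subset_rfl (hX'.trans hAX)
      · exact hs.mono subset_rfl (subset_inter (hY'.trans hBY) hN)
    have hl : NbhdColourable G G N₀ A B ∨ NbhdColourable G Gᶜ N₀ A B := by
      cases b
      · refine Or.inl (hleft G fun u hu => ?_)
        simpa [hq] using (Prod.mk.inj hu.2).2
      · refine Or.inr (hleft Gᶜ fun u hu hs => hX ⟨u, mem_univ u, ?_, hs⟩)
        simpa [hq] using (Prod.mk.inj hu.2).2
    have hr : NbhdColourable G G N₀ B A ∨ NbhdColourable G Gᶜ N₀ B A := by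
      cases a
      · refine Or.inl (hright G fun u hu => ?_)
        simpa [hq] using (Prod.mk.inj hu.2).1
      · refine Or.inr (hright Gᶜ fun u hu hs => hY ⟨u, mem_univ u, ?_, hs⟩)
        simpa [hq] using (Prod.mk.inj hu.2).1
    have h02 : N₀ ≤ max 2 N₀ := le_max_right _ _
    rcases hl with hl | hl <;> rcases hr with hr | hr
    · exact (colourable_of_nbhdColourable ht (le_max_left _ _) hG.path hd
        (hl.mono subset_rfl subset_rfl h02) (hr.mono subset_rfl subset_rfl h02)).mono_card
        (le_max_right _ _)
    · refine (hmix V Gᶜ A B hG.path_compl (by simpa using hG.path) hd (hG.chain_compl _ _)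
        ?_ hr.compl).of_compl.mono_card (le_max_left _ _)
      rw [compl_compl]
      exact hl.compl
    · exact (hmix V G A B hG.path hG.path_compl hd (hG.chain _ _) hl hr).mono_card
        (le_max_left _ _)
    · exact (colourable_of_nbhdColourable ht (le_max_left _ _) hG.path_compl hd
        (hl.compl.mono subset_rfl subset_rfl h02)
        (hr.compl.mono subset_rfl subset_rfl h02)).of_compl.mono_card (le_max_right _ _)

theorem tame_of_not_semiInduced {t k : ℕ} {G : SimpleGraph V}
    (h1 : ¬ SemiInduced (pathBipRel t) G)
    (h2 : ¬ SemiInduced (fun x y => ¬ pathBipRel t x y) G)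
    (h3 : ¬ SemiInduced (halfRel k) G) : Tame t (2 * (k + 1)) G where
  path := h1
  path_compl := by
    rintro ⟨f, g, hf, hg, hne, hadj⟩
    refine h2 ⟨f, g, hf, hg, hne, fun x y => ?_⟩
    change _ ↔ ¬ pathBipRel t x y
    rw [← hadj x y, SimpleGraph.compl_adj]
    have := hne x y
    tauto
  chain X Y h := h3 (AltChain.semiInduced (k := k) (AltChain.of_succ (AltChain.of_succ h)))
  chain_compl X Y h := by
    obtain ⟨u, -, h⟩ := AltChain.of_succ (n := 2 * k + 1) h
    rw [compl_compl] at h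
    exact h3 (AltChain.semiInduced h)

end CographPartition

theorem stmt2 (t k : ℕ) (ht : 1 ≤ t) (hk : 1 ≤ k) :
    ∃ N : ℕ, ∀ (V : Type) (_ : Fintype V) (G : SimpleGraph V),
      ¬ SemiInduced (pathBipRel t) G →
      ¬ SemiInduced (fun x y => ¬ pathBipRel t x y) G →
      ¬ SemiInduced (halfRel k) G →
      ∃ c : V → Fin N,
        (∀ i : Fin N, IsCograph (G.induce (c ⁻¹' {i}))) ∧
        (∀ i j : Fin N, i ≠ j →
          ∃ H : SimpleGraph {v : V // c v = i ∨ c v = j},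
            IsCograph H ∧
            ∀ a b : {v : V // c v = i ∨ c v = j},
              c a.val = i → c b.val = j → (H.Adj a b ↔ G.Adj a.val b.val)) := by
  open CographPartition in
  obtain ⟨r, hr⟩ := exists_altChain_of_splits ((k + 1) + (k + 1))
  obtain ⟨N, hN⟩ := exists_colourable_of_not_splits ht (2 * (k + 1)) (r + r)
  refine ⟨N, fun V _ G h1 h2 h3 => ?_⟩
  have hG := tame_of_not_semiInduced h1 h2 h3
  have hs : ¬ Splits G Set.univ r Set.univ := fun h =>
    (hr (k + 1) (k + 1) rfl V G _ _ h).elim (hG.chain _ _) (hG.chain_compl _ _)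
  obtain ⟨c, hc⟩ := hN r r rfl V G Set.univ Set.univ hG (Or.inl rfl) hs hs
  refine ⟨c, fun i => ?_, fun i j _ => ?_⟩
  · obtain ⟨H, hH, hadj⟩ := hc i i
    rintro ⟨f, hf, h⟩
    refine hH ⟨fun u => (f u : V), Subtype.val_injective.comp hf, fun u v huv => ?_⟩
    rw [hadj _ ⟨trivial, (f u).2⟩ _ ⟨trivial, (f v).2⟩]
    exact h u v huv
  · obtain ⟨H, hH, hadj⟩ := hc i j
    refine ⟨H.comap Subtype.val, ?_, fun a b ha hb => hadj _ ⟨trivial, ha⟩ _ ⟨trivial, hb⟩⟩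
    rintro ⟨f, hf, h⟩
    exact hH ⟨fun u => (f u : V), Subtype.val_injective.comp hf, fun u v huv => h u v huv⟩
end

section
/- For every pair of integers t, k ≥ 1 there exists an integer N such that every finite simple graph G that contains none of P_t, the complement of P_t, and R_k as an induced subgraph satisfies χ(G) ≤ N · ω(G), where χ(G) is the chromatic number and ω(G) is the clique number of G. -/
namespace LinearChi

open Set

variable {V : Type*}

/-- `S` induces a connected subgraph of `G`, expressed through cuts. -/
def ConnOn (G : SimpleGraph V) (S : Set V) : Prop :=
  ∀ A ⊆ S, A.Nonempty → A ≠ S → ∃ a ∈ A, ∃ b ∈ S \ A, G.Adj a b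

/-- `X` is the vertex set of a connected component of the subgraph induced by `S`. -/
structure IsComp (G : SimpleGraph V) (S X : Set V) : Prop where
  subset : X ⊆ S
  nonempty : X.Nonempty
  conn : ConnOn G X
  closed : ∀ a ∈ X, ∀ b ∈ S \ X, ¬ G.Adj a b

/-- The subgraph induced by `S` has a proper colouring with `n` colours. -/
def ColOn (G : SimpleGraph V) (S : Set V) (n : ℕ) : Prop :=
  ∃ c : V → ℕ, ∀ x ∈ S, c x < n ∧ ∀ y ∈ S, G.Adj x y → c x ≠ c y

/-- The clique number of the subgraph induced by `S`. -/
noncomputable def omegaOn (G : SimpleGraph V) (S : Set V) : ℕ :=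
  sSup {n | ∃ T : Finset V, (T : Set V) ⊆ S ∧ G.IsNClique n T}

/-- `S` contains the universal threshold graph of order `k`, described recursively: add an
isolated vertex and then a dominating one. -/
def HasThreshold (G : SimpleGraph V) : ℕ → Set V → Prop
  | 0, _ => True
  | k + 1, S => ∃ a ∈ S, ∃ b ∈ S, G.Adj a b ∧ ∃ X ⊆ S, b ∉ X ∧
      (∀ x ∈ X, G.Adj a x ∧ ¬ G.Adj b x) ∧ HasThreshold G k X

theorem connOn_insert {G : SimpleGraph V} {K : Set V} {d : V} (hK : ConnOn G K) {y : V} (hy : y ∈ K) (hdy : G.Adj d y) :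
    ConnOn G (insert d K) := by
  intro A hA hne hAX
  by_cases hAd : A ∩ K = ∅
  · have hdA : d ∈ A := by
      obtain ⟨z, hz⟩ := hne
      rcases hA hz with rfl | h
      · exact hz
      · exact absurd (show z ∈ A ∩ K from ⟨hz, h⟩) (by simp [hAd])
    exact ⟨d, hdA, y, ⟨Or.inr hy, fun h => absurd (show y ∈ A ∩ K from ⟨h, hy⟩)
      (by simp [hAd])⟩, hdy⟩
  · by_cases hAX' : A ∩ K = K
    · have hyA : y ∈ A := (hAX'.symm ▸ hy : y ∈ A ∩ K).1
      refine ⟨y, hyA, d, ⟨mem_insert _ _, fun hdA => hAX (hA.antisymm ?_)⟩, hdy.symm⟩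
      exact insert_subset hdA (fun z hz => (hAX'.symm ▸ hz : z ∈ A ∩ K).1)
    · obtain ⟨a, ha, b, hb, hab⟩ := hK (A ∩ K) inter_subset_right
        (nonempty_iff_ne_empty.2 hAd) hAX'
      exact ⟨a, ha.1, b, ⟨Or.inr hb.1, fun h => hb.2 ⟨h, hb.1⟩⟩, hab⟩

section Components

variable {G : SimpleGraph V} {S X : Set V}

theorem exists_isComp [Finite V] {x : V} (hx : x ∈ S) : ∃ X, x ∈ X ∧ IsComp G S X := by
  obtain ⟨X, hX⟩ := Set.Finite.exists_minimal
    (s := {X : Set V | x ∈ X ∧ X ⊆ S ∧ ∀ a ∈ X, ∀ b ∈ S \ X, ¬ G.Adj a b}) (Set.toFinite _)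
    ⟨S, hx, subset_rfl, fun a _ b hb => absurd hb.1 hb.2⟩
  obtain ⟨⟨hxX, hXS, hcl⟩, hmin⟩ := hX
  refine ⟨X, hxX, hXS, ⟨x, hxX⟩, ?_, hcl⟩
  intro A hA hne hAX
  by_contra! hcut
  by_cases hxA : x ∈ A
  · have := hmin (y := A) ⟨hxA, hA.trans hXS, fun a ha b hb => by
      by_cases hbX : b ∈ X
      · exact hcut a ha b ⟨hbX, hb.2⟩
      · exact hcl a (hA ha) b ⟨hb.1, hbX⟩⟩ hA
    exact hAX (hA.antisymm this)
  · have := hmin (y := X \ A) ⟨⟨hxX, hxA⟩, sdiff_subset.trans hXS, fun a ha b hb hab => by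
      by_cases hbX : b ∈ X
      · have hbA : b ∈ A := by by_contra h; exact hb.2 ⟨hbX, h⟩
        exact hcut b hbA a ha hab.symm
      · exact hcl a ha.1 b ⟨hb.1, hbX⟩ hab⟩ sdiff_subset
    obtain ⟨y, hy⟩ := hne
    exact (this (hA hy)).2 hy

theorem IsComp.of_diff {Y : Set V} (hX : IsComp G S X) (hY : IsComp G (S \ X) Y) :
    IsComp G S Y := by
  refine ⟨hY.subset.trans sdiff_subset, hY.nonempty, hY.conn, fun a ha b hb hab => ?_⟩
  by_cases hbX : b ∈ X
  · exact hX.closed b hbX a (hY.subset ha) hab.symm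
  · exact hY.closed a ha b ⟨⟨hb.1, hbX⟩, hb.2⟩ hab

theorem comp_induction [Finite V] {P Q : Set V → Prop} (h0 : Q ∅)
    (hs : ∀ S X, IsComp G S X → P X → Q (S \ X) → Q S) (S : Set V)
    (hS : ∀ X, IsComp G S X → P X) : Q S := by
  induction S using WellFoundedLT.induction with
  | ind S ih =>
    rcases S.eq_empty_or_nonempty with rfl | ⟨x, hx⟩
    · exact h0
    · obtain ⟨X, hxX, hX⟩ := exists_isComp (G := G) hx
      refine hs S X hX (hS X hX) (ih _ ?_ fun Y hY => hS Y (hX.of_diff hY))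
      exact ⟨sdiff_subset, fun h => (h hx).2 hxX⟩

/-- Induction along an induced path: if `G` has no induced path on `t + 1` vertices, then a
property of rooted connected sets that propagates from the components of `K` minus the closed
neighbourhood of the root holds at depth `t`. -/
theorem path_induction {t : ℕ} (hG : ¬ ContainsInduced (pathG (t + 1)) G)
    {P : ℕ → V → Set V → Prop}
    (step : ∀ r p K, ConnOn G K → p ∈ K →
      (∀ X, IsComp G {x | x ∈ K ∧ x ≠ p ∧ ¬ G.Adj p x} X →
        ∀ d ∈ K, G.Adj p d → (∃ x ∈ X, G.Adj d x) → P r d (insert d X)) → P (r + 1) p K)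
    {p : V} {K : Set V} (hK : ConnOn G K) (hp : p ∈ K) : P (t + 1) p K := by
  suffices H : ∀ r n p K (f : ℕ → V), n + r = t + 1 → ConnOn G K → p ∈ K → f n = p →
      (∀ i < n, f i ∉ K) → (∀ i < n, ∀ x ∈ K, x ≠ p → ¬ G.Adj (f i) x) →
      (∀ i j, i < j → j ≤ n → f i ≠ f j ∧ (G.Adj (f i) (f j) ↔ i + 1 = j)) → P r p K by
    exact H (t + 1) 0 p K (fun _ => p) (by omega) hK hp rfl (by omega) (by omega)
      (by intro i j; omega)
  intro r
  induction r with
  | zero =>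
    intro n p K f hn _ _ _ _ _ hf
    exfalso
    apply hG
    refine ⟨fun i => f i, ?_, ?_⟩
    · intro i j hij
      by_contra hne
      rcases lt_or_gt_of_ne hne with h | h
      · exact (hf i j h (by omega)).1 hij
      · exact (hf j i h (by omega)).1 hij.symm
    · intro i j hne
      simp only [pathG, SimpleGraph.fromRel_adj]
      rcases lt_or_gt_of_ne hne with h | h
      · rw [(hf i j h (by omega)).2]
        have : (i : ℕ) < j := h
        constructor
        · exact fun h => ⟨hne, Or.inl h⟩
        · rintro ⟨_, h | h⟩ <;> omega
      · rw [G.adj_comm, (hf j i h (by omega)).2]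
        have : (j : ℕ) < i := h
        constructor
        · exact fun h => ⟨hne, Or.inr h⟩
        · rintro ⟨_, h | h⟩ <;> omega
  | succ r ih =>
    intro n p K f hn hK hp hfn hfK hfa hf
    refine step r p K hK hp fun X hX d hd hpd ⟨y, hy, hdy⟩ => ?_
    have hXK : X ⊆ K := fun x hx => (hX.subset hx).1
    have hsub : insert d X ⊆ K := insert_subset hd hXK
    have hpX : p ∉ insert d X := by
      rintro (h | h)
      · exact hpd.ne h
      · exact (hX.subset h).2.1 rfl
    refine ih (n + 1) d (insert d X) (fun i => if i ≤ n then f i else d) (by omega)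
      (connOn_insert hX.conn hy hdy) (mem_insert _ _) (by simp) ?_ ?_ ?_
    · intro i hi
      rw [if_pos (by omega)]
      rcases (show i < n ∨ i = n by omega) with h | rfl
      · exact fun h' => hfK i h (hsub h')
      · rwa [hfn]
    · intro i hi x hx hxd
      rw [if_pos (by omega)]
      rcases (show i < n ∨ i = n by omega) with h | rfl
      · exact hfa i h x (hsub hx) fun e => hpX (e ▸ hx)
      · rw [hfn]
        rcases hx with h | h
        · exact absurd h hxd
        · exact (hX.subset h).2.2
    · intro i j hij hj
      rw [if_pos (by omega)]
      rcases (show j ≤ n ∨ j = n + 1 by omega) with h | rfl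
      · rw [if_pos h]
        exact hf i j hij h
      · rw [if_neg (by omega)]
        rcases (show i < n ∨ i = n by omega) with h | rfl
        · refine ⟨fun e => hfK i h (e ▸ hd), fun h' => ?_, fun h' => by omega⟩
          exact absurd h' (hfa i h d hd hpd.ne')
        · rw [hfn]
          exact ⟨hpd.ne, fun _ => rfl, fun _ => hpd⟩

/-- A component of a connected set minus the closed neighbourhood of `p` is attached to a
neighbour of `p`. -/
theorem exists_attachment {K : Set V} {p : V} (hK : ConnOn G K) (hp : p ∈ K)
    (hX : IsComp G {x | x ∈ K ∧ x ≠ p ∧ ¬ G.Adj p x} X) :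
    ∃ d ∈ K, G.Adj p d ∧ ∃ x ∈ X, G.Adj d x := by
  obtain ⟨a, ha, b, hb, hab⟩ := hK X (fun x hx => (hX.subset hx).1) hX.nonempty
    (fun h => (hX.subset (h.symm ▸ hp : p ∈ X)).2.1 rfl)
  refine ⟨b, hb.1, ?_, a, ha, hab.symm⟩
  by_contra hpb
  refine hX.closed a ha b ⟨⟨hb.1, ?_, hpb⟩, hb.2⟩ hab
  rintro rfl
  exact (hX.subset ha).2.2 hab.symm

theorem IsComp.adj_of_compl (hX : IsComp Gᶜ S X) {a b : V} (ha : a ∈ X) (hb : b ∈ S \ X) :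
    G.Adj a b := by
  by_contra h
  refine hX.closed a ha b hb ((SimpleGraph.compl_adj _ _ _).2 ⟨?_, h⟩)
  rintro rfl
  exact hb.2 ha

end Components

section Colouring

variable {G : SimpleGraph V} {S T : Set V} {m n : ℕ}

theorem ColOn.mono (h : ColOn G T n) (hS : S ⊆ T) (hn : n ≤ m) : ColOn G S m := by
  obtain ⟨c, hc⟩ := h
  exact ⟨c, fun x hx => ⟨(hc x (hS hx)).1.trans_le hn, fun y hy => (hc x (hS hx)).2 y (hS hy)⟩⟩

theorem colOn_empty : ColOn G ∅ n := ⟨fun _ => 0, by simp⟩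

theorem colOn_singleton (x : V) : ColOn G {x} 1 := ⟨fun _ => 0, by simp⟩

theorem ColOn.union (hS : ColOn G S m) (hT : ColOn G T n) : ColOn G (S ∪ T) (m + n) := by
  classical
  obtain ⟨c, hc⟩ := hS
  obtain ⟨e, he⟩ := hT
  refine ⟨fun x => if x ∈ S then c x else m + e x, fun x hx => ⟨?_, fun y hy hxy => ?_⟩⟩
  · dsimp only
    split_ifs with h
    · have := (hc x h).1
      omega
    · have := (he x (hx.resolve_left h)).1
      omega
  · dsimp only
    split_ifs with h h' h'
    · exact (hc x h).2 y h' hxy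
    · have := (hc x h).1
      omega
    · have := (hc y h').1
      omega
    · have := (he x (hx.resolve_left h)).2 y (hy.resolve_left h') hxy
      omega

theorem colOn_of_isComp [Finite V] (h : ∀ X, IsComp G S X → ColOn G X n) : ColOn G S n := by
  classical
  refine comp_induction (Q := fun S => ColOn G S n) colOn_empty ?_ S h
  rintro S X hX ⟨c, hc⟩ ⟨e, he⟩
  refine ⟨fun x => if x ∈ X then c x else e x, fun x hx => ⟨?_, fun y hy hxy => ?_⟩⟩
  · dsimp only
    split_ifs with h
    · exact (hc x h).1
    · exact (he x ⟨hx, h⟩).1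
  · dsimp only
    split_ifs with h h' h'
    · exact (hc x h).2 y h' hxy
    · exact absurd hxy (hX.closed x h y ⟨hy, h'⟩)
    · exact absurd hxy.symm (hX.closed y h' x ⟨hx, h⟩)
    · exact (he x ⟨hx, h⟩).2 y ⟨hy, h'⟩ hxy

end Colouring

section CliqueNumber

variable [Finite V] {G : SimpleGraph V} {S T X : Set V}

theorem card_le_omegaOn {T : Finset V} (hT : (T : Set V) ⊆ S) (hc : G.IsClique (T : Set V)) :
    T.card ≤ omegaOn G S := by
  have := Fintype.ofFinite V
  refine le_csSup ⟨Fintype.card V, ?_⟩ ⟨T, hT, hc, rfl⟩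
  rintro n ⟨T, -, hT⟩
  exact hT.card_eq ▸ T.card_le_univ

theorem exists_clique (G : SimpleGraph V) (S : Set V) :
    ∃ T : Finset V, (T : Set V) ⊆ S ∧ G.IsClique (T : Set V) ∧ T.card = omegaOn G S := by
  have := Fintype.ofFinite V
  have h : omegaOn G S ∈ {n | ∃ T : Finset V, (T : Set V) ⊆ S ∧ G.IsNClique n T} := by
    refine Nat.sSup_mem ⟨0, ∅, by simp, by simp⟩ ⟨Fintype.card V, ?_⟩
    rintro n ⟨T, -, hT⟩
    exact hT.card_eq ▸ T.card_le_univ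
  obtain ⟨T, hT, hc⟩ := h
  exact ⟨T, hT, hc.isClique, hc.card_eq⟩

theorem omegaOn_mono (h : S ⊆ T) : omegaOn G S ≤ omegaOn G T := by
  obtain ⟨A, hA, hc, hcard⟩ := exists_clique G S
  exact hcard ▸ card_le_omegaOn (hA.trans h) hc

theorem omegaOn_pos (h : S.Nonempty) : 1 ≤ omegaOn G S := by
  obtain ⟨x, hx⟩ := h
  simpa using card_le_omegaOn (G := G) (S := S) (T := {x}) (by simpa) (by simp)

theorem omegaOn_insert_le (d : V) (S : Set V) :
    omegaOn G (insert d S) ≤ omegaOn G S + 1 := by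
  classical
  obtain ⟨A, hA, hc, hcard⟩ := exists_clique G (insert d S)
  have h : (A.erase d).card ≤ omegaOn G S := by
    refine card_le_omegaOn (fun x hx => ?_) (hc.subset (by simp))
    simp only [Finset.coe_erase, mem_sdiff, mem_singleton_iff] at hx
    exact (hA hx.1).resolve_left hx.2
  have := Finset.pred_card_le_card_erase (s := A) (a := d)
  omega

theorem omegaOn_add_le (hXS : X ⊆ S) (h : ∀ a ∈ X, ∀ b ∈ S \ X, G.Adj a b) :
    omegaOn G X + omegaOn G (S \ X) ≤ omegaOn G S := by
  classical
  obtain ⟨A, hA, hAc, hAcard⟩ := exists_clique G X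
  obtain ⟨B, hB, hBc, hBcard⟩ := exists_clique G (S \ X)
  have hdisj : Disjoint A B :=
    Finset.disjoint_left.2 fun x hx hx' => (hB hx').2 (hA hx)
  rw [← hAcard, ← hBcard, ← Finset.card_union_of_disjoint hdisj]
  refine card_le_omegaOn ?_ ?_
  · rw [Finset.coe_union]
    exact union_subset (hA.trans hXS) (hB.trans sdiff_subset)
  · intro x hx y hy hne
    simp only [Finset.coe_union, mem_union] at hx hy
    rcases hx with hx | hx <;> rcases hy with hy | hy
    · exact hAc hx hy hne
    · exact h x (hA hx) y (hB hy)
    · exact (h y (hA hy) x (hB hx)).symm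
    · exact hBc hx hy hne

theorem colOn_of_isComp_compl {c : ℕ} (h : ∀ X, IsComp Gᶜ S X → ColOn G X (c * omegaOn G X)) :
    ColOn G S (c * omegaOn G S) := by
  refine comp_induction (Q := fun S => ColOn G S (c * omegaOn G S)) colOn_empty ?_ S h
  intro S X hX h1 h2
  refine (h1.union h2).mono (by rw [union_sdiff_self]; exact subset_union_right) ?_
  rw [← mul_add]
  exact Nat.mul_le_mul_left c (omegaOn_add_le hX.subset fun a ha b hb => hX.adj_of_compl ha hb)

end CliqueNumber

section Threshold

variable {G : SimpleGraph V}

theorem HasThreshold.mono {S T : Set V} (hST : S ⊆ T) :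
    ∀ {k : ℕ}, HasThreshold G k S → HasThreshold G k T
  | 0, _ => trivial
  | _ + 1, ⟨a, ha, b, hb, hab, X, hX, h⟩ =>
    ⟨a, hST ha, b, hST hb, hab, X, hX.trans hST, h⟩

theorem HasThreshold.exists_seq [Nonempty V] {k : ℕ} {S : Set V} (h : HasThreshold G k S) :
    ∃ a b : ℕ → V, (∀ i < k, a i ∈ S ∧ b i ∈ S ∧ G.Adj (a i) (b i)) ∧
      ∀ i j, i < j → j < k → G.Adj (a i) (a j) ∧ G.Adj (a i) (b j) ∧ ¬ G.Adj (b i) (a j) ∧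
        ¬ G.Adj (b i) (b j) ∧ b i ≠ a j ∧ b i ≠ b j := by
  induction k generalizing S with
  | zero =>
    obtain ⟨x⟩ := ‹Nonempty V›
    exact ⟨fun _ => x, fun _ => x, by simp, by simp⟩
  | succ k ih =>
    obtain ⟨a, ha, b, hb, hab, X, hXS, hbX, hX, hk⟩ := h
    obtain ⟨f, g, h1, h2⟩ := ih hk
    refine ⟨fun i => i.casesOn a f, fun i => i.casesOn b g, ?_, ?_⟩
    · rintro (_ | i) hi
      · exact ⟨ha, hb, hab⟩
      · have := h1 i (by omega)
        exact ⟨hXS this.1, hXS this.2.1, this.2.2⟩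
    · rintro (_ | i) (_ | j) hij hj
      · omega
      · obtain ⟨hf, hg, -⟩ := h1 j (by omega)
        exact ⟨(hX _ hf).1, (hX _ hg).1, (hX _ hf).2, (hX _ hg).2,
          fun e => hbX ((show b = f j from e) ▸ hf),
          fun e => hbX ((show b = g j from e) ▸ hg)⟩
      · omega
      · exact h2 i j (by omega) (by omega)

theorem HasThreshold.containsInduced {k : ℕ} {S : Set V} (h : HasThreshold G k S) :
    ContainsInduced (Rgraph k) G := by
  rcases isEmpty_or_nonempty V with hV | hV
  · cases k with
    | zero => exact ⟨fun x => x.elim Fin.elim0 Fin.elim0, fun x => x.elim Fin.elim0 Fin.elim0,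
        fun x => x.elim Fin.elim0 Fin.elim0⟩
    | succ k => exact hV.elim h.choose
  obtain ⟨a, b, h1, h2⟩ := h.exists_seq
  have hab : ∀ i j : Fin k, a i ≠ b j := by
    intro i j
    rcases lt_trichotomy i j with h | rfl | h
    · exact (h2 i j h j.2).2.1.ne
    · exact (h1 i i.2).2.2.ne
    · exact (h2 j i h i.2).2.2.2.2.1.symm
  have hadj : ∀ i j : Fin k, G.Adj (a i) (b j) ↔ i ≤ j := by
    intro i j
    rcases lt_trichotomy i j with h | rfl | h
    · exact iff_of_true (h2 i j h j.2).2.1 h.le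
    · exact iff_of_true (h1 i i.2).2.2 le_rfl
    · exact iff_of_false (fun e => (h2 j i h i.2).2.2.1 e.symm) (not_le.2 h)
  refine ⟨Sum.elim (fun i => a i) (fun i => b i), ?_, ?_⟩
  · rintro (i | i) (j | j) hij
    · by_contra hne
      rcases lt_or_gt_of_ne (fun e => hne (congrArg Sum.inl e) : i ≠ j) with h | h
      · exact (h2 i j h j.2).1.ne hij
      · exact (h2 j i h i.2).1.ne hij.symm
    · exact absurd hij (hab i j)
    · exact absurd hij.symm (hab j i)
    · by_contra hne
      rcases lt_or_gt_of_ne (fun e => hne (congrArg Sum.inr e) : i ≠ j) with h | h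
      · exact (h2 i j h j.2).2.2.2.2.2 hij
      · exact (h2 j i h i.2).2.2.2.2.2 hij.symm
  · rintro (i | i) (j | j) hne
    · simp only [Rgraph, SimpleGraph.fromRel_adj, Sum.elim_inl]
      refine iff_of_true ?_ ⟨hne, Or.inl trivial⟩
      rcases lt_or_gt_of_ne (fun e => hne (congrArg Sum.inl e) : i ≠ j) with h | h
      · exact (h2 i j h j.2).1
      · exact (h2 j i h i.2).1.symm
    · simpa [Rgraph] using hadj i j
    · rw [G.adj_comm]
      simpa [Rgraph] using hadj j i
    · simp only [Rgraph, SimpleGraph.fromRel_adj, Sum.elim_inr]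
      refine iff_of_false ?_ (by simp)
      rcases lt_or_gt_of_ne (fun e => hne (congrArg Sum.inr e) : i ≠ j) with h | h
      · exact (h2 i j h j.2).2.2.2.1
      · exact fun e => (h2 j i h i.2).2.2.2.1 e.symm

end Threshold

section Bound

variable [Finite V] {G : SimpleGraph V} {S K : Set V} {k M t : ℕ}

/-- In a connected `P_t`-free graph whose common neighbourhoods behave as in an `R_{k+1}`-free
graph, the non-neighbourhood of every vertex has small chromatic number. -/
theorem colOn_nonneighbors (hM : ∀ S, ¬ HasThreshold G k S → ColOn G S (M * omegaOn G S))
    (hS : ¬ HasThreshold G (k + 1) S) (hP : ¬ ContainsInduced (pathG (t + 1)) G)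
    (hKS : K ⊆ S) (hK : ConnOn G K) {p : V} (hp : p ∈ K) :
    ColOn G {x | x ∈ K ∧ ¬ G.Adj p x}
      ((t + 1) * ((t + 1) * (M + 1) + 1) * omegaOn G K) := by
  set w := omegaOn G K with hw
  have hw1 : 1 ≤ w := omegaOn_pos ⟨p, hp⟩
  have hedge : ∀ a ∈ K, ∀ b ∈ K, G.Adj a b →
      ColOn G {x | x ∈ K ∧ G.Adj a x ∧ ¬ G.Adj b x} (M * w + 1) := by
    intro a ha b hb hab
    have h1 : ColOn G {x | x ∈ K ∧ G.Adj a x ∧ ¬ G.Adj b x ∧ x ≠ b} (M * w) := by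
      refine (hM {x | x ∈ K ∧ G.Adj a x ∧ ¬ G.Adj b x ∧ x ≠ b} fun h => hS ?_).mono subset_rfl
        (Nat.mul_le_mul_left M (omegaOn_mono fun x hx => hx.1))
      exact ⟨a, hKS ha, b, hKS hb, hab, _, fun x hx => hKS hx.1, fun h => h.2.2.2 rfl,
        fun x hx => ⟨hx.2.1, hx.2.2.1⟩, h⟩
    refine (h1.union (colOn_singleton b)).mono (fun x hx => ?_) le_rfl
    by_cases hxb : x = b
    · exact Or.inr hxb
    · exact Or.inl ⟨hx.1, hx.2.1, hx.2.2, hxb⟩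
  have hdiff : ∀ u ∈ K, ColOn G {x | x ∈ K ∧ G.Adj u x ∧ ¬ G.Adj p x}
      ((t + 1) * (M * w + 1)) := by
    refine path_induction (G := G) hP (P := fun r p K' => K' ⊆ K → ∀ u ∈ K',
      ColOn G {x | x ∈ K ∧ G.Adj u x ∧ ¬ G.Adj p x} (r * (M * w + 1))) ?_ hK hp subset_rfl
    intro r p K' hK' hp ih hsub u hu
    rcases eq_or_ne u p with rfl | hup
    · exact colOn_empty.mono (fun x hx => hx.2.2 hx.2.1) (Nat.zero_le _)
    by_cases hpu : G.Adj p u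
    · exact (hedge u (hsub hu) p (hsub hp) hpu.symm).mono subset_rfl
        (Nat.le_mul_of_pos_left _ (Nat.succ_pos r))
    obtain ⟨X, huX, hX⟩ := exists_isComp (G := G) (S := {x | x ∈ K' ∧ x ≠ p ∧ ¬ G.Adj p x})
      ⟨hu, hup, hpu⟩
    obtain ⟨d, hd, hpd, hdX⟩ := exists_attachment hK' hp hX
    have h1 := ih X hX d hd hpd hdX
      ((insert_subset hd fun x hx => (hX.subset hx).1).trans hsub) u (Or.inr huX)
    refine (h1.union (hedge d (hsub hd) p (hsub hp) hpd.symm)).mono (fun x hx => ?_)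
      (by rw [Nat.succ_mul])
    by_cases hdx : G.Adj d x
    · exact Or.inr ⟨hx.1, hdx, hx.2.2⟩
    · exact Or.inl ⟨hx.1, hx.2.1, hdx⟩
  set c := (t + 1) * (M * w + 1)
  have hcol : ColOn G {x | x ∈ K ∧ ¬ G.Adj p x} ((t + 1) * (c + 1)) := by
    refine colOn_of_isComp fun X hX => ?_
    obtain ⟨q, hq⟩ := hX.nonempty
    refine path_induction (G := G) hP (P := fun r _ X => X ⊆ {x | x ∈ K ∧ ¬ G.Adj p x} →
      ColOn G X (r * (c + 1))) ?_ hX.conn hq hX.subset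
    intro r q X hX hq ih hsub
    have hrest : ColOn G {x | x ∈ X ∧ x ≠ q ∧ ¬ G.Adj q x} (r * (c + 1)) := by
      refine colOn_of_isComp fun Y hY => ?_
      obtain ⟨d, hd, hqd, hdY⟩ := exists_attachment hX hq hY
      exact (ih Y hY d hd hqd hdY ((insert_subset hd fun x hx => (hY.subset hx).1).trans
        hsub)).mono (subset_insert _ _) le_rfl
    refine (hrest.union ((hdiff q (hsub hq).1).union (colOn_singleton q))).mono
      (fun x hx => ?_) (by rw [Nat.succ_mul])
    by_cases hxq : x = q
    · exact Or.inr (Or.inr hxq)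
    by_cases hqx : G.Adj q x
    · exact Or.inr (Or.inl ⟨(hsub hx).1, hqx, (hsub hx).2⟩)
    · exact Or.inl ⟨hx, hxq, hqx⟩
  refine hcol.mono subset_rfl ?_
  rw [mul_assoc]
  refine Nat.mul_le_mul_left _ ?_
  have : c ≤ (t + 1) * ((M + 1) * w) := Nat.mul_le_mul_left _ (by nlinarith)
  nlinarith

/-- A set that is dominated by a vertex and is not connected inherits the bound for
`R_k`-free graphs. -/
theorem colOn_of_not_connOn (hM : ∀ S, ¬ HasThreshold G k S → ColOn G S (M * omegaOn G S))
    (hS : ¬ HasThreshold G (k + 1) S) {a : V} (ha : a ∈ S) (hKS : K ⊆ S)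
    (haK : ∀ x ∈ K, G.Adj a x) (hK : ¬ ConnOn G K) : ColOn G K (M * omegaOn G K) := by
  refine colOn_of_isComp fun X hX => ?_
  have hne : (K \ X).Nonempty := by
    rw [nonempty_iff_ne_empty, Ne, sdiff_eq_empty]
    exact fun h => hK (hX.subset.antisymm h ▸ hX.conn)
  obtain ⟨b, hb⟩ := hne
  refine (hM X fun h => hS ?_).mono subset_rfl (Nat.mul_le_mul_left M (omegaOn_mono hX.subset))
  exact ⟨a, ha, b, hKS hb.1, haK b hb.1, X, hX.subset.trans hKS, hb.2,
    fun x hx => ⟨haK x (hX.subset hx), fun e => hX.closed x hx b hb e.symm⟩, h⟩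

/-- The constant in the linear bound for connected and co-connected sets. -/
def primeConst (C M : ℕ) : ℕ → ℕ
  | 0 => 0
  | r + 1 => C + (M + 2 * primeConst C M r)

theorem colOn_of_connOn_of_connOn_compl
    (hM : ∀ S, ¬ HasThreshold G k S → ColOn G S (M * omegaOn G S))
    (hS : ¬ HasThreshold G (k + 1) S) (hP : ¬ ContainsInduced (pathG (t + 1)) G)
    (hPc : ¬ ContainsInduced (pathG (t + 1)) Gᶜ)
    (hKS : K ⊆ S) (hK : ConnOn G K) (hKc : ConnOn Gᶜ K) :
    ColOn G K (primeConst ((t + 1) * ((t + 1) * (M + 1) + 1)) M (t + 1) * omegaOn G K) := by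
  set C := (t + 1) * ((t + 1) * (M + 1) + 1)
  rcases K.eq_empty_or_nonempty with rfl | ⟨p, hp⟩
  · exact colOn_empty
  refine path_induction (G := Gᶜ) hPc (P := fun r _ K => K ⊆ S → ConnOn G K →
    ColOn G K (primeConst C M r * omegaOn G K)) ?_ hKc hp hKS hK
  intro r p K hKc hp ih hKS hK
  have hnon := colOn_nonneighbors hM hS hP hKS hK hp
  set R := {x | x ∈ K ∧ x ≠ p ∧ ¬ Gᶜ.Adj p x} with hR
  have hRadj : ∀ x ∈ R, G.Adj p x := by
    intro x hx
    by_contra h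
    exact hx.2.2 ((SimpleGraph.compl_adj _ _ _).2 ⟨hx.2.1.symm, h⟩)
  have hrest : ColOn G R ((M + 2 * primeConst C M r) * omegaOn G R) := by
    refine colOn_of_isComp_compl fun X hX => ?_
    have hXK : X ⊆ K := fun x hx => (hX.subset hx).1
    have hpX : ∀ x ∈ X, G.Adj p x := fun x hx => hRadj x (hX.subset hx)
    have hpX' : p ∉ X := fun h => (hX.subset h).2.1 rfl
    by_cases hXc : ConnOn G X
    swap
    · exact (colOn_of_not_connOn hM hS (hKS hp) (hXK.trans hKS) hpX hXc).mono subset_rfl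
        (Nat.mul_le_mul_right _ (Nat.le_add_right _ _))
    by_cases hmix : ∃ d ∈ K \ X, (∃ x ∈ X, ¬ G.Adj d x) ∧ ∃ y ∈ X, G.Adj d y
    · obtain ⟨d, hd, ⟨x, hx, hdx⟩, y, hy, hdy⟩ := hmix
      have hdx' : Gᶜ.Adj d x := (SimpleGraph.compl_adj _ _ _).2
        ⟨fun e => hd.2 (e ▸ hx), hdx⟩
      have hpd : Gᶜ.Adj p d := by
        by_contra h
        refine hX.closed x hx d ⟨⟨hd.1, ?_, h⟩, hd.2⟩ hdx'.symm
        rintro rfl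
        exact hdx (hpX x hx)
      refine (ih X hX d hd.1 hpd ⟨x, hx, hdx'⟩
        (insert_subset (hKS hd.1) (hXK.trans hKS)) (connOn_insert hXc hy hdy)).mono
        (subset_insert _ _) ?_
      have h1 := omegaOn_insert_le (G := G) d X
      have h2 := omegaOn_pos (G := G) hX.nonempty
      calc primeConst C M r * omegaOn G (insert d X)
          ≤ primeConst C M r * (2 * omegaOn G X) := Nat.mul_le_mul_left _ (by omega)
        _ = 2 * primeConst C M r * omegaOn G X := by ring
        _ ≤ _ := Nat.mul_le_mul_right _ (Nat.le_add_left _ _)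
    · push Not at hmix
      refine ColOn.mono (hM X fun hk => hS ?_) subset_rfl
        (Nat.mul_le_mul_right _ (Nat.le_add_right _ _))
      obtain ⟨x, hx, d, hd, hxd⟩ := hKc X hXK hX.nonempty (fun e => hpX' (e ▸ hp))
      obtain ⟨b, hb, a, ha, hba⟩ := hK {d | d ∈ K \ X ∧ ∀ y ∈ X, ¬ G.Adj d y}
        (fun x hx => hx.1.1) ⟨d, hd, hmix d hd ⟨x, hx, fun e => hxd.2 e.symm⟩⟩ (fun e => by
          obtain ⟨y, hy⟩ := hX.nonempty
          exact (e.symm ▸ hp : p ∈ {d | d ∈ K \ X ∧ ∀ y ∈ X, ¬ G.Adj d y}).2 y hy (hpX y hy))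
      have haX : a ∉ X := fun h => hb.2 a h hba
      refine ⟨a, hKS ha.1, b, hKS hb.1.1, hba.symm, X, hXK.trans hKS, hb.1.2,
        fun y hy => ⟨?_, hb.2 y hy⟩, hk⟩
      by_contra hay
      exact ha.2 ⟨⟨ha.1, haX⟩, hmix a ⟨ha.1, haX⟩ ⟨y, hy, hay⟩⟩
  refine (hnon.union hrest).mono (fun x hx => ?_) ?_
  · by_cases hpx : G.Adj p x
    · exact Or.inr ⟨hx, hpx.ne', fun e => e.2 hpx⟩
    · exact Or.inl ⟨hx, hpx⟩
  · rw [primeConst, add_mul C]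
    exact Nat.add_le_add_left (Nat.mul_le_mul_left _ (omegaOn_mono fun x hx => hx.1)) _

/-- The constant in the linear bound for graphs without `P_{t+1}`, its complement and `R_k`. -/
def chiConst (t : ℕ) : ℕ → ℕ
  | 0 => 0
  | k + 1 => chiConst t k +
      primeConst ((t + 1) * ((t + 1) * (chiConst t k + 1) + 1)) (chiConst t k) (t + 1)

theorem colOn_of_not_hasThreshold (hP : ¬ ContainsInduced (pathG (t + 1)) G)
    (hPc : ¬ ContainsInduced (pathG (t + 1)) Gᶜ) (hS : ¬ HasThreshold G k S) :
    ColOn G S (chiConst t k * omegaOn G S) := by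
  induction k generalizing S with
  | zero => exact absurd trivial hS
  | succ k ih =>
    have hM : ∀ S, ¬ HasThreshold G k S → ColOn G S (chiConst t k * omegaOn G S) :=
      fun S hS => ih hS
    refine colOn_of_isComp fun X hX => ?_
    refine ColOn.mono (n := chiConst t (k + 1) * omegaOn G X) ?_ subset_rfl
      (Nat.mul_le_mul_left _ (omegaOn_mono hX.subset))
    refine colOn_of_isComp_compl fun Y hY => ?_
    by_cases hYc : ConnOn G Y
    · exact (colOn_of_connOn_of_connOn_compl hM hS hP hPc (hY.subset.trans hX.subset) hYc
        hY.conn).mono subset_rfl (Nat.mul_le_mul_right _ (Nat.le_add_left _ _))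
    · have hne : (X \ Y).Nonempty := by
        rw [nonempty_iff_ne_empty, Ne, sdiff_eq_empty]
        exact fun h => hYc (hY.subset.antisymm h ▸ hX.conn)
      obtain ⟨a, ha⟩ := hne
      exact (colOn_of_not_connOn hM hS (hX.subset ha.1) (hY.subset.trans hX.subset)
        (fun y hy => (hY.adj_of_compl hy ha).symm) hYc).mono subset_rfl
        (Nat.mul_le_mul_right _ (Nat.le_add_right _ _))

end Bound

theorem ContainsInduced.compl {W : Type*} {H : SimpleGraph W} {G : SimpleGraph V}
    (h : ContainsInduced H Gᶜ) : ContainsInduced Hᶜ G := by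
  obtain ⟨f, hf, hadj⟩ := h
  refine ⟨f, hf, fun u v huv => ?_⟩
  have := hadj u v huv
  rw [SimpleGraph.compl_adj] at this ⊢
  have hne := hf.ne huv
  tauto

theorem ColOn.colorable {G : SimpleGraph V} {n : ℕ} (h : ColOn G univ n) : G.Colorable n := by
  obtain ⟨c, hc⟩ := h
  exact ⟨SimpleGraph.Coloring.mk (fun x => (⟨c x, (hc x (mem_univ x)).1⟩ : Fin n))
    fun {x y} hxy e => (hc x (mem_univ x)).2 y (mem_univ y) hxy (congrArg Fin.val e)⟩

theorem omegaOn_univ (G : SimpleGraph V) : omegaOn G univ = G.cliqueNum := by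
  simp [omegaOn, SimpleGraph.cliqueNum]

end LinearChi

theorem stmt4 (t k : ℕ) (ht : 1 ≤ t) (hk : 1 ≤ k) :
    ∃ N : ℕ, ∀ (V : Type) (_ : Fintype V) (G : SimpleGraph V),
      ¬ ContainsInduced (pathG t) G →
      ¬ ContainsInduced (pathG t)ᶜ G →
      ¬ ContainsInduced (Rgraph k) G →
      G.chromaticNumber ≤ ((N * G.cliqueNum : ℕ) : ℕ∞) := by
  obtain ⟨t, rfl⟩ : ∃ s, t = s + 1 := ⟨t - 1, by omega⟩
  refine ⟨LinearChi.chiConst t k, fun V _ G hP hPc hR => ?_⟩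
  have h := LinearChi.colOn_of_not_hasThreshold (S := Set.univ) hP
    (fun h => hPc (LinearChi.ContainsInduced.compl h)) (fun h => hR h.containsInduced)
  rw [LinearChi.omegaOn_univ] at h
  exact h.colorable.chromaticNumber_le
end

section
/- Let k ≥ 1 be an integer. Every finite simple graph G on n ≥ 1 vertices that does not contain R_k as an induced subgraph contains a homogeneous set (a set of vertices that is a clique or an independent set) of size at least n^{1/(2k)}/4. -/
open Classical in
/-- If every independent subset of `S` has at most `m` elements, then some vertex of `S`
dominates a `1 / m` fraction of `S`. -/
theorem SimpleGraph.exists_card_le_mul_card_filter_adj {V : Type*} (H : SimpleGraph V)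
    (S : Finset V) (hS : S.Nonempty) (m : ℕ)
    (hm : ∀ I ⊆ S, (∀ u ∈ I, ∀ v ∈ I, ¬ H.Adj u v) → I.card ≤ m) :
    ∃ v ∈ S, S.card ≤ m * ((S.filter (H.Adj v)).card + 1) := by
  let F := S.powerset.filter (fun I => ∀ u ∈ I, ∀ v ∈ I, ¬ H.Adj u v)
  have hF : F.Nonempty := ⟨∅, by simp [F]⟩
  obtain ⟨I, hI, hmax⟩ := F.exists_max_image Finset.card hF
  obtain ⟨hIS, hind⟩ : I ⊆ S ∧ ∀ u ∈ I, ∀ v ∈ I, ¬ H.Adj u v := by simpa [F] using hI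
  obtain ⟨v, hv, hvmax⟩ := S.exists_max_image (fun v => (S.filter (H.Adj v)).card) hS
  refine ⟨v, hv, ?_⟩
  have hcover : S ⊆ I.biUnion (fun u => insert u (S.filter (H.Adj u))) := by
    intro w hw
    by_contra hcon
    simp only [Finset.mem_biUnion, Finset.mem_insert, Finset.mem_filter, not_exists, not_and,
      not_or] at hcon
    have hwI : w ∉ I := fun h => (hcon w h).1 rfl
    have hmem : insert w I ∈ F := by
      simp only [F, Finset.mem_filter, Finset.mem_powerset]
      refine ⟨Finset.insert_subset hw hIS, ?_⟩
      intro x hx y hy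
      rcases Finset.mem_insert.1 hx with hxw | hx <;> rcases Finset.mem_insert.1 hy with hyw | hy
      · exact hxw ▸ hyw ▸ H.irrefl
      · exact fun h => (hcon y hy).2 hw (hxw ▸ h.symm)
      · exact hyw ▸ (hcon x hx).2 hw
      · exact hind x hx y hy
    have := hmax _ hmem
    rw [Finset.card_insert_of_notMem hwI] at this
    omega
  calc S.card ≤ _ := Finset.card_le_card hcover
    _ ≤ I.card * ((S.filter (H.Adj v)).card + 1) :=
        Finset.card_biUnion_le_card_mul _ _ _ fun u hu =>
          (Finset.card_insert_le _ _).trans (Nat.succ_le_succ (hvmax u (hIS hu)))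
    _ ≤ _ := Nat.mul_le_mul_right _ (hm I hIS hind)

open Classical in
theorem SimpleGraph.exists_pow_le_card_filter_adj {V : Type*} (H : SimpleGraph V)
    (S : Finset V) (m t : ℕ) (hm1 : 1 ≤ m)
    (hm : ∀ I ⊆ S, (∀ u ∈ I, ∀ v ∈ I, ¬ H.Adj u v) → I.card ≤ m)
    (hcard : (2 * m) ^ (t + 1) ≤ S.card) :
    ∃ v ∈ S, (2 * m) ^ t ≤ (S.filter (H.Adj v)).card := by
  have hpos : 0 < (2 * m) ^ t := by positivity
  have hS : S.Nonempty := Finset.card_pos.1 (lt_of_lt_of_le (by positivity) hcard)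
  obtain ⟨v, hv, hle⟩ := H.exists_card_le_mul_card_filter_adj S hS m hm
  refine ⟨v, hv, ?_⟩
  have h1 : m * (2 * (2 * m) ^ t) ≤ m * ((S.filter (H.Adj v)).card + 1) :=
    le_trans (le_of_eq (by ring)) (hcard.trans hle)
  have h2 := Nat.le_of_mul_le_mul_left h1 hm1
  omega

open Classical in
/-- A large vertex set without large homogeneous subsets spans a universal threshold graph. -/
theorem SimpleGraph.exists_threshold_of_homogeneous_card_le {V : Type*} (G : SimpleGraph V)
    (m : ℕ) (hm1 : 1 ≤ m)
    (hclique : ∀ I : Finset V, (∀ u ∈ I, ∀ v ∈ I, u ≠ v → G.Adj u v) → I.card ≤ m)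
    (hindep : ∀ I : Finset V, (∀ u ∈ I, ∀ v ∈ I, ¬ G.Adj u v) → I.card ≤ m)
    (k : ℕ) (S : Finset V) (hS : (2 * m) ^ (2 * k) ≤ S.card) :
    ∃ a b : Fin k → V, (∀ i, a i ∈ S) ∧ (∀ i, b i ∈ S) ∧
      (∀ i j, i ≠ j → G.Adj (a i) (a j)) ∧ (∀ i j, ¬ G.Adj (b i) (b j)) ∧
      Function.Injective b ∧ (∀ i j, a i ≠ b j) ∧ (∀ i j, G.Adj (a i) (b j) ↔ i ≤ j) := by
  induction k generalizing S with
  | zero =>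
    exact ⟨Fin.elim0, Fin.elim0, fun i => i.elim0, fun i => i.elim0, fun i => i.elim0,
      fun i => i.elim0, fun i => i.elim0, fun i => i.elim0, fun i => i.elim0⟩
  | succ k ih =>
    obtain ⟨x, hx, hxc⟩ := G.exists_pow_le_card_filter_adj S m (2 * k + 1) hm1
      (fun I _ => hindep I) hS
    obtain ⟨y, hy, hyc⟩ := Gᶜ.exists_pow_le_card_filter_adj _ m (2 * k) hm1
      (fun I _ hI => hclique I fun u hu v hv huv => by
        have := hI u hu v hv
        rw [SimpleGraph.compl_adj] at this
        tauto) hxc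
    obtain ⟨a, b, haS, hbS, haa, hbb, hinj, hab, hadj⟩ := ih _ hyc
    simp only [Finset.mem_filter, SimpleGraph.compl_adj] at hy haS hbS
    refine ⟨Fin.cons x a, Fin.cons y b, ?_, ?_, ?_, ?_, ?_, ?_, ?_⟩
    · exact Fin.cases hx fun i => (haS i).1.1
    · exact Fin.cases hy.1 fun i => (hbS i).1.1
    · refine Fin.cases (Fin.cases (by simp) fun j _ => (haS j).1.2) fun i =>
        Fin.cases (fun _ => (haS i).1.2.symm) fun j hij => haa i j fun h => hij (by rw [h])
    · exact Fin.cases (Fin.cases G.irrefl fun j => (hbS j).2.2) fun i =>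
        Fin.cases (fun h => (hbS i).2.2 h.symm) fun j => hbb i j
    · exact Fin.cons_injective_iff.2 ⟨by rintro ⟨i, hi⟩; exact (hbS i).2.1 hi.symm, hinj⟩
    · exact Fin.cases (Fin.cases hy.2.ne fun j => (hbS j).1.2.ne) fun i =>
        Fin.cases (haS i).2.1.symm fun j => hab i j
    · refine Fin.cases (fun j => iff_of_true ?_ (Fin.zero_le j)) fun i => Fin.cases ?_ fun j => ?_
      · exact Fin.cases hy.2 (fun j => (hbS j).1.2) j
      · exact iff_of_false (fun h => (haS i).2.2 h.symm) (by simp)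
      · simpa using hadj i j

theorem stmt5 (k : ℕ) (hk : 1 ≤ k) (V : Type) [Fintype V]
    (G : SimpleGraph V) (hn : 1 ≤ Fintype.card V)
    (h : ¬ ContainsInduced (Rgraph k) G) :
    ∃ s : Finset V,
      ((∀ u ∈ s, ∀ v ∈ s, u ≠ v → G.Adj u v) ∨ (∀ u ∈ s, ∀ v ∈ s, ¬ G.Adj u v)) ∧
      (Fintype.card V : ℝ) ^ ((1 : ℝ) / (2 * k)) / 4 ≤ (s.card : ℝ) := by
  by_contra! hcon
  set x : ℝ := (Fintype.card V : ℝ) ^ ((1 : ℝ) / (2 * k)) / 4 with hx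
  have hx0 : 0 ≤ x := by positivity
  obtain ⟨v⟩ : Nonempty V := Fintype.card_pos_iff.1 hn
  have hx1 : 1 < x := by
    have := hcon {v} (Or.inr (by simp))
    simpa using this
  have hpow : (4 * x) ^ (2 * k) = Fintype.card V := by
    have h4 : 4 * x = (Fintype.card V : ℝ) ^ (((2 * k : ℕ) : ℝ)⁻¹) := by
      rw [hx]; push_cast; rw [one_div]; ring
    rw [h4, Real.rpow_inv_natCast_pow (by positivity) (by omega)]
  have hfl : (⌊x⌋₊ : ℝ) ≤ x := Nat.floor_le hx0
  have hS : (2 * ⌊x⌋₊) ^ (2 * k) ≤ (Finset.univ : Finset V).card := by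
    rw [Finset.card_univ, ← Nat.cast_le (α := ℝ), ← hpow]
    push_cast
    exact pow_le_pow_left₀ (by positivity) (by linarith) _
  obtain ⟨a, b, -, -, haa, hbb, hinj, hab, hadj⟩ :=
    G.exists_threshold_of_homogeneous_card_le ⌊x⌋₊ (Nat.le_floor (by exact_mod_cast hx1.le))
      (fun I hI => Nat.le_floor (hcon I (Or.inl hI)).le)
      (fun I hI => Nat.le_floor (hcon I (Or.inr hI)).le) k Finset.univ hS
  refine h ⟨Sum.elim a b, ?_, ?_⟩
  · refine Function.Injective.sumElim (fun i j hij => ?_) hinj hab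
    by_contra hne
    exact (haa i j hne).ne hij
  · rintro (i | i) (j | j) hij
    · have hne : i ≠ j := fun e => hij (by rw [e])
      simpa [Rgraph, hne] using haa i j hne
    · simpa [Rgraph] using hadj i j
    · simpa [Rgraph, G.adj_comm] using hadj j i
    · simpa [Rgraph] using hbb i j
end

section
/- Every threshold graph with at most k vertices is an induced subgraph of R_k. -/
/-- A finite graph is a threshold graph if its vertices can be enumerated so that
each vertex is adjacent either to all earlier vertices or to none of them. -/
def IsThreshold {W : Type*} [Fintype W] (T : SimpleGraph W) : Prop :=
  ∃ e : Fin (Fintype.card W) ≃ W,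
    ∀ i : Fin (Fintype.card W),
      (∀ j : Fin (Fintype.card W), j < i → T.Adj (e j) (e i)) ∨
      (∀ j : Fin (Fintype.card W), j < i → ¬ T.Adj (e j) (e i))

theorem Rgraph_adj_inl_inl {k : ℕ} {i j : Fin k} :
    (Rgraph k).Adj (Sum.inl i) (Sum.inl j) ↔ i ≠ j := by
  simp [Rgraph]

theorem Rgraph_adj_inl_inr {k : ℕ} {i j : Fin k} :
    (Rgraph k).Adj (Sum.inl i) (Sum.inr j) ↔ i ≤ j := by
  simp [Rgraph]

theorem Rgraph_not_adj_inr_inr {k : ℕ} {i j : Fin k} :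
    ¬ (Rgraph k).Adj (Sum.inr i) (Sum.inr j) := by
  simp [Rgraph]

theorem ContainsInduced.of_enumeration {n : ℕ} {W V : Type*} {H : SimpleGraph W}
    {G : SimpleGraph V} (e : Fin n ≃ W) (g : Fin n → V) (hg : Function.Injective g)
    (h : ∀ i j, i < j → (G.Adj (g i) (g j) ↔ H.Adj (e i) (e j))) :
    ContainsInduced H G := by
  refine ⟨g ∘ e.symm, hg.comp e.symm.injective, fun u v huv => ?_⟩
  rcases lt_or_gt_of_ne (e.symm.injective.ne huv) with hlt | hlt
  · simpa using h _ _ hlt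
  · simpa [SimpleGraph.adj_comm] using h _ _ hlt

theorem stmt6 (k : ℕ) (W : Type) [Fintype W] (T : SimpleGraph W)
    (hT : IsThreshold T) (hcard : Fintype.card W ≤ k) :
    ContainsInduced T (Rgraph k) := by
  classical
  obtain ⟨e, he⟩ := hT
  let r : Fin (Fintype.card W) → Fin k := fun i => (Fin.castLE hcard i).rev
  have hr : StrictAnti r := fun i j hij => by simpa [r] using hij
  -- Later vertices get smaller indices; dominating vertices go to the clique.
  refine ContainsInduced.of_enumeration e
    (fun i => if ∀ j, j < i → T.Adj (e j) (e i) then Sum.inl (r i) else Sum.inr (r i)) ?_ ?_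
  · intro i j hij
    apply hr.injective
    dsimp only at hij
    split_ifs at hij <;> simpa using hij
  · intro i j hij
    have hlt := hr hij
    by_cases hj : ∀ l, l < j → T.Adj (e l) (e j)
    · rw [if_pos hj, iff_true_right (hj i hij)]
      split_ifs
      · exact Rgraph_adj_inl_inl.2 hlt.ne'
      · exact (Rgraph_adj_inl_inr.2 hlt.le).symm
    · rw [if_neg hj, iff_false_right ((he j).resolve_left hj i hij)]
      split_ifs
      · exact fun h => hlt.not_ge (Rgraph_adj_inl_inr.1 h)
      · exact Rgraph_not_adj_inr_inr
end

section
/- Let T be a threshold graph with k vertices. If a finite simple graph G does not contain T as an induced subgraph, then G contains no strong configuration of order 2k (i.e., the strong index of G is smaller than 2k). -/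
/-- `G` contains a strong configuration of order `k`. -/
def StrongConfig {V : Type*} (G : SimpleGraph V) (k : ℕ) : Prop :=
  ∃ a b : Fin k → V,
    Function.Injective a ∧ Function.Injective b ∧
    (∀ i j : Fin k, a i ≠ b j) ∧
    (∀ i j : Fin k, i ≠ j → G.Adj (a i) (a j)) ∧
    (∀ i j : Fin k, ¬ G.Adj (b i) (b j)) ∧
    (∀ i j : Fin k, i < j → G.Adj (a i) (b j) ∧ ¬ G.Adj (b i) (a j))

theorem stmt9 (W : Type) [Fintype W] (T : SimpleGraph W) (hT : IsThreshold T)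
    (k : ℕ) (hk : Fintype.card W = k)
    (V : Type) [Fintype V] (G : SimpleGraph V)
    (h : ¬ ContainsInduced T G) :
    ¬ StrongConfig G (2 * k) := by
  classical
  subst hk
  obtain ⟨e, he⟩ := hT
  rintro ⟨a, b, ha, hb, hab, haa, hbb, hmix⟩
  apply h
  let D (i : Fin (Fintype.card W)) : Prop := ∀ j, j < i → T.Adj (e j) (e i)
  -- Reversing the enumeration makes every later vertex precede the earlier ones.
  let p (i : Fin (Fintype.card W)) : Fin (2 * Fintype.card W) :=
    ⟨Fintype.card W - 1 - i, by have := i.isLt; omega⟩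
  have hp : ∀ i j, j < i → p i < p j := by
    intro i j hij
    have := i.isLt
    simp only [p, Fin.lt_def] at hij ⊢
    omega
  have hp_inj : Function.Injective p := by
    intro i j hij
    rcases lt_trichotomy i j with hlt | heq | hlt
    · exact absurd hij (hp j i hlt).ne'
    · exact heq
    · exact absurd hij (hp i j hlt).ne
  let g (i : Fin (Fintype.card W)) : V := if D i then a (p i) else b (p i)
  have hg_inj : Function.Injective g := by
    intro i j hij
    simp only [g] at hij
    split_ifs at hij
    · exact hp_inj (ha hij)
    · exact absurd hij (hab _ _)
    · exact absurd hij.symm (hab _ _)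
    · exact hp_inj (hb hij)
  have hg_adj : ∀ i j, j < i → (G.Adj (g i) (g j) ↔ T.Adj (e i) (e j)) := by
    intro i j hij
    have hlt := hp i j hij
    by_cases hi : D i
    · refine iff_of_true ?_ (hi j hij).symm
      simp only [g, if_pos hi]
      split_ifs
      · exact haa _ _ hlt.ne
      · exact (hmix _ _ hlt).1
    · refine iff_of_false ?_ fun hadj => ((he i).resolve_left hi) j hij hadj.symm
      simp only [g, if_neg hi]
      split_ifs
      · exact (hmix _ _ hlt).2
      · exact hbb _ _
  refine ⟨g ∘ e.symm, hg_inj.comp e.symm.injective, fun u v huv => ?_⟩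
  rcases lt_or_gt_of_ne (e.symm.injective.ne huv) with hlt | hlt
  · simpa [G.adj_comm, T.adj_comm] using hg_adj _ _ hlt
  · simpa using hg_adj _ _ hlt
end
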